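/- arXiv:2410.22341 — 6 statements merged into one kernel-verified Lean document; each statement's English description precedes it below -/
import Mathlib

section
/- Every averaging system whose graphs have at most m connected components at every time can be interpreted as an m-twist system with the same s-energy: if x₁ ≤ … ≤ x_n are the sorted agent positions at time t and y₁ ≤ … ≤ y_n the sorted positions at time t+1, then for each block [x_u, x_v] of G_t (with corresponding sorted index interval [u,v]) and every i ∈ [u,v], (1−ρ)x_u + ρ·x_{min(i+1,v)} ≤ y_i ≤ ρ·x_{max(i−1,u)} + (1−ρ)x_v, while y_i = x_i for indices outside all blocks; consequently the block partition at each step makes the sorted orbit a valid m-twist system whose s-energy equals that of the averaging system, and hence 𝓔_{m,s} ≤ 𝓔^tw_{m,s}. -/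
open scoped BigOperators ENNReal

/-- An averaging system on `n` agents with weight threshold `ρ`: a sequence of
row-stochastic matrices `P t` whose positive entries (the edges of the graph `G t`,
including a self-loop at every vertex) are at least `ρ`, with symmetric support,
together with the orbit `x (t+1) = P t * x t`. -/
structure AvgSystem (n : ℕ) (ρ : ℝ) where
  P : ℕ → Matrix (Fin n) (Fin n) ℝ
  x : ℕ → Fin n → ℝ
  nonneg : ∀ t i j, 0 ≤ P t i j
  rowSum : ∀ t i, ∑ j, P t i j = 1
  diagPos : ∀ t i, 0 < P t i i
  symm : ∀ t i j, P t i j = 0 ↔ P t j i = 0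
  threshold : ∀ t i j, P t i j ≠ 0 → ρ ≤ P t i j
  update : ∀ t, x (t + 1) = (P t).mulVec (x t)

/-- The union of the embedded edges of `G t` on the real line. -/
def AvgSystem.edgeUnion {n : ℕ} {ρ : ℝ} (S : AvgSystem n ρ) (t : ℕ) : Set ℝ :=
  ⋃ (i : Fin n) (j : Fin n) (_ : S.P t i j ≠ 0), Set.uIcc (S.x t i) (S.x t j)

/-- The blocks of a union of embedded edges: its connected components. -/
def blockSet (U : Set ℝ) : Set (Set ℝ) :=
  {C | ∃ a ∈ U, C = connectedComponentIn U a}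

/-- `E_{s,t}`: the sum of the `s`-th powers of the block lengths. -/
noncomputable def stepEnergy (s : ℝ) (U : Set ℝ) : ℝ≥0∞ :=
  ∑' C : blockSet U, ENNReal.ofReal (Metric.diam (C : Set ℝ) ^ s)

/-- The `s`-energy of an averaging system. -/
noncomputable def AvgSystem.energy {n : ℕ} {ρ : ℝ} (S : AvgSystem n ρ) (s : ℝ) : ℝ≥0∞ :=
  ∑' t : ℕ, stepEnergy s (S.edgeUnion t)

/-- Every graph `G t` of the system has at most `m` connected components. -/
def AvgSystem.componentsLE {n : ℕ} {ρ : ℝ} (S : AvgSystem n ρ) (m : ℕ) : Prop :=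
  ∀ t : ℕ, ∃ c : Fin n → Fin m,
    (∀ i j, S.P t i j ≠ 0 → c i = c j) ∧
    (∀ i j, c i = c j → Relation.ReflTransGen (fun a b => S.P t a b ≠ 0) i j)

open scoped BigOperators ENNReal

/-- An `m`-twist system with weight threshold `ρ` on `n` agents: sorted configurations
`x t 0 ≤ … ≤ x t (n-1)`; at each time a partition of `{0,…,n-1}` into at most `m`
integer intervals (blocks) `[u, v] ∈ B t` is chosen, and within each block the next
configuration satisfies the twist constraints. -/
structure TwistSystem (n : ℕ) (ρ : ℝ) (m : ℕ) where
  x : ℕ → ℕ → ℝ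
  B : ℕ → Finset (ℕ × ℕ)
  mono : ∀ t j k, j ≤ k → k < n → x t j ≤ x t k
  block_le : ∀ t, ∀ q ∈ B t, q.1 ≤ q.2 ∧ q.2 < n
  block_card : ∀ t, (B t).card ≤ m
  partition : ∀ t k, k < n → ∃! q, q ∈ B t ∧ q.1 ≤ k ∧ k ≤ q.2
  twist : ∀ t, ∀ q ∈ B t, ∀ i, q.1 ≤ i → i ≤ q.2 →
    (1 - ρ) * x t q.1 + ρ * x t (min (i + 1) q.2) ≤ x (t + 1) i ∧
    x (t + 1) i ≤ ρ * x t (max (i - 1) q.1) + (1 - ρ) * x t q.2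

/-- The `s`-energy of an `m`-twist system: the sum over all times of the `s`-th powers
of the block lengths. -/
noncomputable def TwistSystem.energy {n : ℕ} {ρ : ℝ} {m : ℕ}
    (S : TwistSystem n ρ m) (s : ℝ) : ℝ≥0∞ :=
  ∑' t : ℕ, ∑ q ∈ S.B t, ENNReal.ofReal ((S.x t q.2 - S.x t q.1) ^ s)

/-- `𝓔^tw_{m,s}`: the supremum of the `s`-energy over all `m`-twist systems with
`x(0) ∈ [0,1]^n`. -/
noncomputable def maxTwistEnergy (n : ℕ) (ρ : ℝ) (m : ℕ) (s : ℝ) : ℝ≥0∞ :=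
  sSup {E | ∃ S : TwistSystem n ρ m,
    (∀ k, k < n → S.x 0 k ∈ Set.Icc (0 : ℝ) 1) ∧ E = S.energy s}

/-- `𝓔_{m,s}`: the supremum of the `s`-energy over all averaging systems with at most
`m` connected components at each time and `x(0) ∈ [0,1]^n`. -/
noncomputable def maxAvgEnergy (n : ℕ) (ρ : ℝ) (m : ℕ) (s : ℝ) : ℝ≥0∞ :=
  sSup {E | ∃ S : AvgSystem n ρ,
    S.componentsLE m ∧ (∀ i, S.x 0 i ∈ Set.Icc (0 : ℝ) 1) ∧ E = S.energy s}

theorem aux_low {n : ℕ} (f w : Fin n → ℝ) (τ : Equiv.Perm (Fin n)) (hw : Monotone w)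
    (hwf : ∀ i, w i = f (τ i)) (c : ℝ) (i l : Fin n) (hl : l ≤ i)
    (h : ∀ j, (i < j ∨ j = l) → c ≤ f j) : c ≤ w i := by
  by_contra hc
  push Not at hc
  have hsub : (Finset.Iic i).image τ ⊆ (Finset.Iic i).erase l := by
    intro a ha
    simp only [Finset.mem_image, Finset.mem_Iic] at ha
    obtain ⟨j, hj, rfl⟩ := ha
    have h1 : f (τ j) < c := by
      rw [← hwf]; exact lt_of_le_of_lt (hw hj) hc
    simp only [Finset.mem_erase, Finset.mem_Iic]
    constructor
    · intro he
      exact absurd (h _ (Or.inr he)) (not_le.2 h1)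
    · by_contra hlt
      exact absurd (h _ (Or.inl (not_le.1 hlt))) (not_le.2 h1)
  have h2 := Finset.card_le_card hsub
  rw [Finset.card_image_of_injective _ τ.injective,
    Finset.card_erase_of_mem (Finset.mem_Iic.2 hl)] at h2
  have : 0 < (Finset.Iic i).card := Finset.card_pos.2 ⟨i, by simp⟩
  omega

theorem aux_high {n : ℕ} (f w : Fin n → ℝ) (τ : Equiv.Perm (Fin n)) (hw : Monotone w)
    (hwf : ∀ i, w i = f (τ i)) (c : ℝ) (i l : Fin n) (hl : i ≤ l)
    (h : ∀ j, (j < i ∨ j = l) → f j ≤ c) : w i ≤ c := by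
  by_contra hc
  push Not at hc
  have hsub : (Finset.Ici i).image τ ⊆ (Finset.Ici i).erase l := by
    intro a ha
    simp only [Finset.mem_image, Finset.mem_Ici] at ha
    obtain ⟨j, hj, rfl⟩ := ha
    have h1 : c < f (τ j) := by
      rw [← hwf]; exact lt_of_lt_of_le hc (hw hj)
    simp only [Finset.mem_erase, Finset.mem_Ici]
    constructor
    · intro he
      exact absurd (h _ (Or.inr he)) (not_le.2 h1)
    · by_contra hlt
      exact absurd (h _ (Or.inl (not_le.1 hlt))) (not_le.2 h1)
  have h2 := Finset.card_le_card hsub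
  rw [Finset.card_image_of_injective _ τ.injective,
    Finset.card_erase_of_mem (Finset.mem_Ici.2 hl)] at h2
  have : 0 < (Finset.Ici i).card := Finset.card_pos.2 ⟨i, by simp⟩
  omega

theorem aux_avg_ge {n : ℕ} {ρ : ℝ} (p z : Fin n → ℝ) (hp : ∀ k, 0 ≤ p k) (hs : ∑ k, p k = 1)
    (L : ℝ) (hL : ∀ k, p k ≠ 0 → L ≤ z k) (b : Fin n) (hb : ρ ≤ p b) (hbL : L ≤ z b) :
    (1 - ρ) * L + ρ * z b ≤ ∑ k, p k * z k := by
  have h1 : ∑ k, p k * z k = L + ∑ k, p k * (z k - L) := by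
    simp only [mul_sub, Finset.sum_sub_distrib, ← Finset.sum_mul, hs]; ring
  have h2 : p b * (z b - L) ≤ ∑ k, p k * (z k - L) := by
    apply Finset.single_le_sum (f := fun k => p k * (z k - L)) _ (Finset.mem_univ b)
    intro k _
    by_cases hk : p k = 0
    · simp [hk]
    · exact mul_nonneg (hp k) (sub_nonneg.2 (hL k hk))
  have h3 : ρ * (z b - L) ≤ p b * (z b - L) :=
    mul_le_mul_of_nonneg_right hb (sub_nonneg.2 hbL)
  rw [h1]; linarith

theorem aux_avg_le {n : ℕ} {ρ : ℝ} (p z : Fin n → ℝ) (hp : ∀ k, 0 ≤ p k) (hs : ∑ k, p k = 1)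
    (R : ℝ) (hR : ∀ k, p k ≠ 0 → z k ≤ R) (b : Fin n) (hb : ρ ≤ p b) (hbR : z b ≤ R) :
    ∑ k, p k * z k ≤ ρ * z b + (1 - ρ) * R := by
  have := aux_avg_ge (ρ := ρ) p (fun k => - z k) hp hs (-R) (fun k hk => neg_le_neg (hR k hk)) b hb
    (neg_le_neg hbR)
  simp only [mul_neg, Finset.sum_neg_distrib] at this
  linarith

theorem aux_core {n m : ℕ} {ρ s : ℝ} (hn : 2 ≤ n) (hρ0 : 0 < ρ) (hρ1 : ρ ≤ 1 / 2)
    (z : Fin n → ℝ) (hz : Monotone z) (Q : Fin n → Fin n → ℝ)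
    (nonneg : ∀ i j, 0 ≤ Q i j) (rowSum : ∀ i, ∑ j, Q i j = 1)
    (diag : ∀ i, Q i i ≠ 0) (symm : ∀ i j, Q i j ≠ 0 → Q j i ≠ 0)
    (thr : ∀ i j, Q i j ≠ 0 → ρ ≤ Q i j)
    (c : Fin n → Fin m)
    (hc : ∀ i j, c i = c j → Relation.ReflTransGen (fun a b => Q a b ≠ 0) i j)
    (U : Set ℝ) (hU : ∀ a, a ∈ U ↔ ∃ i j, Q i j ≠ 0 ∧ a ∈ Set.uIcc (z i) (z j))
    (w : Fin n → ℝ) (τ : Equiv.Perm (Fin n)) (hw : Monotone w)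
    (hwf : ∀ i, w i = ∑ k, Q (τ i) k * z k) :
    ∃ B : Finset (Fin n × Fin n), (∀ q ∈ B, q.1 ≤ q.2) ∧ B.card ≤ m ∧
      (∀ k, ∃! q, q ∈ B ∧ q.1 ≤ k ∧ k ≤ q.2) ∧
      (∀ q ∈ B, ∀ i, q.1 ≤ i → i ≤ q.2 →
        (∀ j : Fin n, (j : ℕ) = min ((i : ℕ) + 1) q.2 → (1 - ρ) * z q.1 + ρ * z j ≤ w i) ∧
        (∀ j : Fin n, (j : ℕ) = max ((i : ℕ) - 1) q.1 → w i ≤ ρ * z j + (1 - ρ) * z q.2)) ∧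
      ∑ q ∈ B, ENNReal.ofReal ((z q.2 - z q.1) ^ s) = stepEnergy s U := by
  classical
  have : Nonempty (Fin n) := ⟨⟨0, by omega⟩⟩
  set C : Fin n → Set ℝ := fun k => connectedComponentIn U (z k) with hC
  have hzU : ∀ k, z k ∈ U := fun k => (hU _).2 ⟨k, k, diag k, by simp⟩
  have hself : ∀ k, z k ∈ C k := fun k => mem_connectedComponentIn (hzU k)
  have hCU : ∀ k, C k ⊆ U := fun k => connectedComponentIn_subset _ _
  have hconn : ∀ k, (C k).OrdConnected := fun k =>
    isPreconnected_connectedComponentIn.ordConnected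
  have hmem : ∀ j k, z j ∈ C k → C j = C k := fun j k h => (connectedComponentIn_eq h).symm
  -- edges
  have hedge : ∀ i j, Q i j ≠ 0 → ∀ a ∈ Set.uIcc (z i) (z j),
      connectedComponentIn U a = C i ∧ connectedComponentIn U a = C j := by
    intro i j hij a ha
    have hsub : Set.uIcc (z i) (z j) ⊆ connectedComponentIn U a :=
      isPreconnected_uIcc.subset_connectedComponentIn ha
        (fun b hb => (hU b).2 ⟨i, j, hij, hb⟩)
    exact ⟨connectedComponentIn_eq (hsub Set.left_mem_uIcc),
      connectedComponentIn_eq (hsub Set.right_mem_uIcc)⟩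
  have hQC : ∀ i j, Q i j ≠ 0 → C i = C j := fun i j hij => by
    have := hedge i j hij _ Set.left_mem_uIcc
    exact this.1.symm.trans this.2
  have hcC : ∀ i j, c i = c j → C i = C j := by
    intro i j hij
    have := hc i j hij
    induction this with
    | refl => rfl
    | tail _ h ih => 
      rename_i a b h0
      exact (Relation.ReflTransGen.head_induction_on (motive := fun x _ => C x = C a) h0 rfl
        (fun h1 _ h2 => (hQC _ _ h1).trans h2)).trans (hQC _ _ h)
  have hconv : ∀ j l k, j ≤ l → l ≤ k → C j = C k → C l = C k := by
    intro j l k hjl hlk h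
    apply hmem
    exact (hconn k).out (h ▸ hself j) (hself k) ⟨hz hjl, hz hlk⟩
  have hex : ∀ D, D ∈ Finset.univ.image C → ∃ q : Fin n × Fin n, q.1 ≤ q.2 ∧
      ∀ j, C j = D ↔ q.1 ≤ j ∧ j ≤ q.2 := by
    intro D hD
    simp only [Finset.mem_image, Finset.mem_univ, true_and] at hD
    obtain ⟨k, rfl⟩ := hD
    set F := Finset.univ.filter (fun j => C j = C k) with hF
    have hne : F.Nonempty := ⟨k, by simp [hF]⟩
    have h1 : C (F.min' hne) = C k := by
      exact (Finset.mem_filter.1 (F.min'_mem hne)).2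
    have h2 : C (F.max' hne) = C k := by
      exact (Finset.mem_filter.1 (F.max'_mem hne)).2
    refine ⟨(F.min' hne, F.max' hne), F.min'_le_max' hne, fun j => ⟨fun hj => ?_, fun hj => ?_⟩⟩
    · have : j ∈ F := by simp [hF, hj]
      exact ⟨F.min'_le _ this, F.le_max' _ this⟩
    · rw [← h2]; exact hconv _ _ _ hj.1 hj.2 (h1.trans h2.symm)
  choose! e he1 he2 using hex
  have hu : ∀ D ∈ Finset.univ.image C, C (e D).1 = D := fun D hD =>
    (he2 D hD _).2 ⟨le_rfl, he1 D hD⟩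
  have hv : ∀ D ∈ Finset.univ.image C, C (e D).2 = D := fun D hD =>
    (he2 D hD _).2 ⟨he1 D hD, le_rfl⟩
  have hinj : Set.InjOn e (Finset.univ.image C : Finset (Set ℝ)) := by
    intro D hD D' hD' h
    rw [← hu D hD, ← hu D' hD', h]
  have hIcc : ∀ D ∈ Finset.univ.image C, D = Set.Icc (z (e D).1) (z (e D).2) := by
    intro D hD
    apply Set.Subset.antisymm
    · intro a ha
      have haU : a ∈ U := by
        rw [← hu D hD] at ha; exact hCU _ ha
      have haD : connectedComponentIn U a = D := by
        rw [← hu D hD] at ha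
        exact (connectedComponentIn_eq ha).symm.trans (hu D hD)
      obtain ⟨i, j, hij, hm⟩ := (hU a).1 haU
      obtain ⟨h1, h2⟩ := hedge i j hij a hm
      have h3 := (he2 D hD i).1 (h1.symm.trans haD)
      have h4 := (he2 D hD j).1 (h2.symm.trans haD)
      exact (Set.uIcc_subset_Icc ⟨hz h3.1, hz h3.2⟩ ⟨hz h4.1, hz h4.2⟩) hm
    · have h1 := hself (e D).1
      have h2 := hself (e D).2
      have h3 := hconn (e D).1
      rw [hu D hD] at h1 h3
      rw [hv D hD] at h2
      exact h3.out h1 h2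
  have hDk : ∀ k, C k ∈ Finset.univ.image C := fun k => by simp
  -- a crossing edge
  have hcross : ∀ D ∈ Finset.univ.image C, ∀ i j : Fin n, (e D).1 ≤ i → j ≤ (e D).2 →
      (i : ℕ) + 1 = j → z i < z j → ∃ a b, Q a b ≠ 0 ∧ Q b a ≠ 0 ∧ (e D).1 ≤ a ∧ a ≤ i ∧
        j ≤ b ∧ b ≤ (e D).2 := by
    intro D hD i j hi hj hij hlt
    set μ := (z i + z j) / 2 with hμ
    have hμD : μ ∈ D := by
      rw [hIcc D hD]
      have h1 := hz hi
      have h2 := hz hj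
      constructor <;> linarith
    have hμU : μ ∈ U := by
      rw [← hu D hD] at hμD; exact hCU _ hμD
    have hμC : connectedComponentIn U μ = D := by
      rw [← hu D hD] at hμD
      exact (connectedComponentIn_eq hμD).symm.trans (hu D hD)
    obtain ⟨a, b, hab, hm⟩ := (hU μ).1 hμU
    obtain ⟨h1, h2⟩ := hedge a b hab μ hm
    have h3 := (he2 D hD a).1 (h1.symm.trans hμC)
    have h4 := (he2 D hD b).1 (h2.symm.trans hμC)
    have hle : ∀ k, z k ≤ μ → k ≤ i := by
      intro k hk
      by_contra hki
      have : j ≤ k := by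
        rw [Fin.le_def]; rw [not_le, Fin.lt_def] at hki; omega
      have := hz this
      linarith
    have hge : ∀ k, μ ≤ z k → j ≤ k := by
      intro k hk
      by_contra hki
      have : k ≤ i := by
        rw [Fin.le_def]; rw [not_le, Fin.lt_def] at hki; omega
      have := hz this
      linarith
    rcases Set.mem_uIcc.1 hm with ⟨h5, h6⟩ | ⟨h5, h6⟩
    · exact ⟨a, b, hab, symm _ _ hab, h3.1, hle _ h5, hge _ h6, h4.2⟩
    · exact ⟨b, a, symm _ _ hab, hab, h4.1, hle _ h5, hge _ h6, h3.2⟩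
  set f : Fin n → ℝ := fun j => ∑ k, Q j k * z k with hf
  have hfl : ∀ D ∈ Finset.univ.image C, ∀ j, (e D).1 ≤ j → j ≤ (e D).2 → ∀ b, Q j b ≠ 0 →
      (1 - ρ) * z (e D).1 + ρ * z b ≤ f j ∧ f j ≤ ρ * z b + (1 - ρ) * z (e D).2 := by
    intro D hD j h1 h2 b hb
    have hcl : ∀ k, Q j k ≠ 0 → (e D).1 ≤ k ∧ k ≤ (e D).2 := fun k hk =>
      (he2 D hD k).1 ((hQC _ _ hk).symm.trans ((he2 D hD j).2 ⟨h1, h2⟩))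
    exact ⟨aux_avg_ge _ z (nonneg j) (rowSum j) _ (fun k hk => hz (hcl k hk).1) b (thr _ _ hb)
        (hz (hcl b hb).1),
      aux_avg_le _ z (nonneg j) (rowSum j) _ (fun k hk => hz (hcl k hk).2) b (thr _ _ hb)
        (hz (hcl b hb).2)⟩
  have hright : ∀ D ∈ Finset.univ.image C, ∀ j, (e D).2 < j → z (e D).2 ≤ f j := by
    intro D hD j hj
    have hcl : ∀ k, Q j k ≠ 0 → z (e D).2 ≤ z k := by
      intro k hk
      apply hz
      by_contra hlt
      have h1 := hconv k (e D).2 j (not_le.1 hlt).le hj.le (hQC _ _ hk).symm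
      have h2 := (he2 D hD j).1 (h1.symm.trans (hv D hD))
      exact absurd h2.2 (not_le.2 hj)
    have := aux_avg_ge _ z (nonneg j) (rowSum j) _ hcl j (thr _ _ (diag j)) (hz hj.le)
    have h3 := mul_nonneg hρ0.le (sub_nonneg.2 (hz hj.le))
    simp only [hf]
    linarith
  have hleft : ∀ D ∈ Finset.univ.image C, ∀ j, j < (e D).1 → f j ≤ z (e D).1 := by
    intro D hD j hj
    have hcl : ∀ k, Q j k ≠ 0 → z k ≤ z (e D).1 := by
      intro k hk
      apply hz
      by_contra hlt
      have h1 := hconv j (e D).1 k hj.le (not_le.1 hlt).le (hQC _ _ hk)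
      have h2 := (he2 D hD j).1 ((hQC _ _ hk).trans (h1.symm.trans (hu D hD)))
      exact absurd h2.1 (not_le.2 hj)
    have := aux_avg_le _ z (nonneg j) (rowSum j) _ hcl j (thr _ _ (diag j)) (hz hj.le)
    have h3 := mul_nonneg hρ0.le (sub_nonneg.2 (hz hj.le))
    simp only [hf]
    linarith
  refine ⟨(Finset.univ.image C).image e, ?_, ?_, ?_, ?_, ?_⟩
  · intro q hq
    obtain ⟨D, hD, rfl⟩ := Finset.mem_image.1 hq
    exact he1 D hD
  · refine Finset.card_image_le.trans ?_
    have hfac : C = (fun d : Fin m => if h : ∃ i, c i = d then C h.choose else ∅) ∘ c := by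
      funext i
      have h : ∃ j, c j = c i := ⟨i, rfl⟩
      simp only [Function.comp, dif_pos h]
      exact hcC _ _ h.choose_spec.symm
    rw [hfac, ← Finset.image_image]
    refine Finset.card_image_le.trans ((Finset.card_le_univ _).trans (by simp))
  · intro k
    refine ⟨e (C k), ⟨Finset.mem_image_of_mem _ (hDk k), (he2 _ (hDk k) k).1 rfl⟩, ?_⟩
    rintro q ⟨hq, hk⟩
    obtain ⟨D, hD, rfl⟩ := Finset.mem_image.1 hq
    rw [(he2 D hD k).2 hk]
  · intro q hq i hi1 hi2
    obtain ⟨D, hD, rfl⟩ := Finset.mem_image.1 hq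
    have hρ' : 0 ≤ 1 - ρ := by linarith
    constructor
    · intro j hj
      have hjv : j ≤ (e D).2 := by rw [Fin.le_def]; omega
      have hij : i ≤ j := by rw [Fin.le_def] at hi2 ⊢; omega
      have hjle : ∀ k, i < k → k ≤ (e D).2 → z j ≤ z k := by
        intro k h1 h2
        apply hz
        rw [Fin.le_def] at h2 ⊢; rw [Fin.lt_def] at h1; omega
      have key : ∃ l b, (e D).1 ≤ l ∧ l ≤ i ∧ Q l b ≠ 0 ∧ z j ≤ z b := by
        rcases (hz hij).eq_or_lt with heq | hlt
        · exact ⟨i, i, hi1, le_rfl, diag i, heq.ge⟩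
        · have hne : (i : ℕ) + 1 = j := by
            have : i ≠ j := fun h => by rw [h] at hlt; exact lt_irrefl _ hlt
            have : (i : ℕ) ≠ j := fun h => this (Fin.ext h)
            rw [Fin.le_def] at hij; omega
          obtain ⟨a, b, h1, _, h3, h4, h5, _⟩ := hcross D hD i j hi1 hjv hne hlt
          exact ⟨a, b, h3, h4, h1, hz h5⟩
      obtain ⟨l, b, hl1, hl2, hlb, hjb⟩ := key
      refine aux_low f w τ hw hwf _ i l hl2 ?_
      rintro k (hk | rfl)
      · rcases le_or_gt k (e D).2 with hkv | hkv
        · have h1 := (hfl D hD k (hi1.trans hk.le) hkv k (diag k)).1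
          have h2 := mul_le_mul_of_nonneg_left (hjle k hk hkv) hρ0.le
          linarith
        · have h1 := hright D hD k hkv
          have h2 := mul_le_mul_of_nonneg_left (hz hjv) hρ0.le
          have h3 := mul_le_mul_of_nonneg_left (hz (he1 D hD)) hρ'
          linarith
      · have h1 := (hfl D hD k hl1 (hl2.trans hi2) b hlb).1
        have h2 := mul_le_mul_of_nonneg_left hjb hρ0.le
        linarith
    · intro j hj
      have hjv : (e D).1 ≤ j := by rw [Fin.le_def]; omega
      have hij : j ≤ i := by rw [Fin.le_def] at hi1 ⊢; omega
      have hjle : ∀ k, k < i → (e D).1 ≤ k → z k ≤ z j := by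
        intro k h1 h2
        apply hz
        rw [Fin.le_def] at h2 ⊢; rw [Fin.lt_def] at h1; omega
      have key : ∃ l b, l ≤ (e D).2 ∧ i ≤ l ∧ Q l b ≠ 0 ∧ z b ≤ z j := by
        rcases (hz hij).eq_or_lt with heq | hlt
        · exact ⟨i, i, hi2, le_rfl, diag i, heq.ge⟩
        · have hne : (j : ℕ) + 1 = i := by
            have : i ≠ j := fun h => by rw [h] at hlt; exact lt_irrefl _ hlt
            have : (i : ℕ) ≠ j := fun h => this (Fin.ext h)
            rw [Fin.le_def] at hij; omega
          obtain ⟨a, b, _, h2, _, h4, h5, h6⟩ := hcross D hD j i hjv hi2 hne hlt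
          exact ⟨b, a, h6, h5, h2, hz h4⟩
      obtain ⟨l, b, hl1, hl2, hlb, hjb⟩ := key
      refine aux_high f w τ hw hwf _ i l hl2 ?_
      rintro k (hk | rfl)
      · rcases le_or_gt (e D).1 k with hkv | hkv
        · have h1 := (hfl D hD k hkv (hk.le.trans hi2) k (diag k)).2
          have h2 := mul_le_mul_of_nonneg_left (hjle k hk hkv) hρ0.le
          linarith
        · have h1 := hleft D hD k hkv
          have h2 := mul_le_mul_of_nonneg_left (hz hjv) hρ0.le
          have h3 := mul_le_mul_of_nonneg_left (hz (he1 D hD)) hρ'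
          linarith
      · have h1 := (hfl D hD k (hi1.trans hl2) hl1 b hlb).2
        have h2 := mul_le_mul_of_nonneg_left hjb hρ0.le
        linarith
  · have hB : blockSet U = ((Finset.univ.image C : Finset (Set ℝ)) : Set (Set ℝ)) := by
      ext D
      simp only [blockSet, Set.mem_ofPred_eq, Finset.coe_image, Finset.coe_univ, Set.image_univ,
        Set.mem_range]
      constructor
      · rintro ⟨a, ha, rfl⟩
        obtain ⟨i, j, hij, hm⟩ := (hU a).1 ha
        exact ⟨i, (hedge i j hij a hm).1.symm⟩
      · rintro ⟨k, rfl⟩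
        exact ⟨z k, hzU k, rfl⟩
    rw [stepEnergy, hB,
      Finset.tsum_subtype' (Finset.univ.image C)
        (fun D : Set ℝ => ENNReal.ofReal (Metric.diam D ^ s)),
      Finset.sum_image hinj]
    refine Finset.sum_congr rfl fun D hD => ?_
    conv_rhs => rw [hIcc D hD]
    rw [Real.diam_Icc (hz (he1 D hD))]

theorem aux_exists {n m : ℕ} {ρ s : ℝ} (hn : 2 ≤ n) (hρ0 : 0 < ρ) (hρ1 : ρ ≤ 1 / 2)
    (S : AvgSystem n ρ) (hS : S.componentsLE m) :
    ∃ T : TwistSystem n ρ m,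
        (∀ t : ℕ, ∃ σ : Fin n → Fin n, Function.Bijective σ ∧
          ∀ k (hk : k < n), T.x t k = S.x t (σ ⟨k, hk⟩)) ∧
        (∀ t : ℕ,
          ∑ q ∈ T.B t, ENNReal.ofReal ((T.x t q.2 - T.x t q.1) ^ s) =
            stepEnergy s (S.edgeUnion t)) := by
  classical
  set σ : ℕ → Equiv.Perm (Fin n) := fun t => Tuple.sort (S.x t) with hσ
  have hmono : ∀ t, Monotone (S.x t ∘ σ t) := fun t => Tuple.monotone_sort _
  choose c _ hc2 using hS
  have hstep := fun t =>
    aux_core (m := m) (ρ := ρ) (s := s) hn hρ0 hρ1 (S.x t ∘ σ t) (hmono t)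
      (fun i j => S.P t (σ t i) (σ t j)) (fun i j => S.nonneg _ _ _)
      (fun i => by
        rw [← S.rowSum t (σ t i)]
        exact Equiv.sum_comp (σ t) (fun j => S.P t (σ t i) j))
      (fun i => (S.diagPos t _).ne')
      (fun i j h => fun h' => h ((S.symm t _ _).2 h'))
      (fun i j h => S.threshold t _ _ h)
      (c t ∘ σ t)
      (fun i j h => by
        have h1 := hc2 t _ _ h
        have h2 := Relation.ReflTransGen.lift (p := fun a b => S.P t (σ t a) (σ t b) ≠ 0)
          (σ t).symm (fun a b hab => by simpa [Function.onFun] using hab) _ _ h1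
        simpa [Function.onFun] using h2)
      (S.edgeUnion t)
      (fun a => by
        simp only [AvgSystem.edgeUnion, Set.mem_iUnion, exists_prop, Function.comp]
        constructor
        · rintro ⟨i, j, h⟩
          exact ⟨(σ t).symm i, (σ t).symm j, by simpa using h⟩
        · rintro ⟨i, j, h⟩
          exact ⟨_, _, h⟩)
      (S.x (t + 1) ∘ σ (t + 1)) ((σ (t + 1)).trans (σ t).symm) (hmono (t + 1))
      (fun i => by
        simp only [Function.comp, S.update t, Matrix.mulVec, dotProduct, Equiv.trans_apply,
          Equiv.apply_symm_apply]
        exact (Equiv.sum_comp (σ t) (fun j => S.P t (σ (t + 1) i) j * S.x t j)).symm)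
  choose B hB1 hB2 hB3 hB4 hB5 using hstep
  set X : ℕ → ℕ → ℝ := fun t k => if h : k < n then S.x t (σ t ⟨k, h⟩) else 0 with hX
  have hXv : ∀ t (k : Fin n), X t k = (S.x t ∘ σ t) k := fun t k => by
    simp [hX, k.2]
  set ι : Fin n × Fin n ↪ ℕ × ℕ :=
    ⟨fun q => (q.1, q.2), fun a b h => by
      simp only [Prod.mk.injEq] at h
      exact Prod.ext (Fin.ext h.1) (Fin.ext h.2)⟩ with hι
  have hιv : ∀ q, ι q = ((q.1 : ℕ), (q.2 : ℕ)) := fun q => rfl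
  refine ⟨⟨X, fun t => (B t).map ι, ?_, ?_, ?_, ?_, ?_⟩, ?_, ?_⟩
  · intro t j k hjk hk
    have := hmono t (show (⟨j, by omega⟩ : Fin n) ≤ ⟨k, hk⟩ from hjk)
    rwa [← hXv, ← hXv] at this
  · intro t q hq
    obtain ⟨q, hq', rfl⟩ := Finset.mem_map.1 hq
    exact ⟨hB1 t q hq', q.2.2⟩
  · intro t
    rw [Finset.card_map]; exact hB2 t
  · intro t k hk
    obtain ⟨q, ⟨h1, h2⟩, h3⟩ := hB3 t ⟨k, hk⟩
    refine ⟨ι q, ⟨Finset.mem_map_of_mem _ h1, h2⟩, ?_⟩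
    rintro _ ⟨hq, h4⟩
    obtain ⟨q', hq', rfl⟩ := Finset.mem_map.1 hq
    rw [h3 q' ⟨hq', h4⟩]
  · intro t q hq i hi1 hi2
    obtain ⟨q, hq', rfl⟩ := Finset.mem_map.1 hq
    rw [hιv] at hi1 hi2 ⊢
    simp only at hi1 hi2 ⊢
    have hq2 := q.2.2
    have hq1 := q.1.2
    obtain ⟨h1, h2⟩ := hB4 t q hq' ⟨i, by omega⟩ hi1 hi2
    have h1' := h1 ⟨min (i + 1) q.2, by omega⟩ rfl
    have h2' := h2 ⟨max (i - 1) q.1, by omega⟩ rfl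
    simp only [← hXv] at h1' h2'
    exact ⟨h1', h2'⟩
  · intro t
    refine ⟨σ t, (σ t).bijective, fun k hk => ?_⟩
    simp [hX, hk]
  · intro t
    rw [← hB5 t]
    simp only [Finset.sum_map, hιv, hXv]

/-- Every averaging system whose graphs have at most `m` connected
components at every time can be interpreted as an `m`-twist system with the same
`s`-energy: there is an `m`-twist system whose configurations are, at each time, the
sorted agent positions of the averaging system and whose per-step block energies
coincide with those of the averaging system; consequently `𝓔_{m,s} ≤ 𝓔^tw_{m,s}`. -/
theorem avg_is_twist (n m : ℕ) (ρ s : ℝ) (hn : 2 ≤ n) (hρ0 : 0 < ρ) (hρ1 : ρ ≤ 1 / 2)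
    (hs0 : 0 < s) (hs1 : s ≤ 1) (hm1 : 1 ≤ m) (hmn : m ≤ n - 1) :
    (∀ S : AvgSystem n ρ, S.componentsLE m → (∀ i, S.x 0 i ∈ Set.Icc (0 : ℝ) 1) →
      ∃ T : TwistSystem n ρ m,
        -- `T` is the sorted version of `S`
        (∀ t : ℕ, ∃ σ : Fin n → Fin n, Function.Bijective σ ∧
          ∀ k (hk : k < n), T.x t k = S.x t (σ ⟨k, hk⟩)) ∧
        -- the block energies agree at each step
        (∀ t : ℕ,
          ∑ q ∈ T.B t, ENNReal.ofReal ((T.x t q.2 - T.x t q.1) ^ s) =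
            stepEnergy s (S.edgeUnion t)) ∧
        T.energy s = S.energy s) ∧
    maxAvgEnergy n ρ m s ≤ maxTwistEnergy n ρ m s := by
  have main : ∀ S : AvgSystem n ρ, S.componentsLE m → (∀ i, S.x 0 i ∈ Set.Icc (0 : ℝ) 1) →
      ∃ T : TwistSystem n ρ m,
        (∀ t : ℕ, ∃ σ : Fin n → Fin n, Function.Bijective σ ∧
          ∀ k (hk : k < n), T.x t k = S.x t (σ ⟨k, hk⟩)) ∧
        (∀ t : ℕ,
          ∑ q ∈ T.B t, ENNReal.ofReal ((T.x t q.2 - T.x t q.1) ^ s) =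
            stepEnergy s (S.edgeUnion t)) ∧
        T.energy s = S.energy s := by
    intro S hS _
    obtain ⟨T, h1, h2⟩ := aux_exists (s := s) hn hρ0 hρ1 S hS
    exact ⟨T, h1, h2, tsum_congr h2⟩
  refine ⟨main, ?_⟩
  apply sSup_le
  rintro E ⟨S, hS, hx, rfl⟩
  obtain ⟨T, h1, _, h3⟩ := main S hS hx
  refine le_sSup ⟨T, fun k hk => ?_, h3.symm⟩
  obtain ⟨σ, _, hσ⟩ := h1 0
  rw [hσ k hk]
  exact hx _
end

section
/- For any z ≥ 1, the maximum 1-energy of m-twist systems satisfies 𝓔^tw_{m,1} ≤ 2·z^{−ν}·𝒦(z), where ν = ⌈n/2⌉ and 𝒦(z) is the supremum over m-twist systems with x(0) ∈ [0,1]^n of the weighted 1-energy K(z) = Σ_{t≥0} K_t(z), with K_t(z) = Σ_{k=1}^n (x_{v(k)}(t) − x_k(t))·z^k and v(k) denoting the right endpoint of the block containing index k at time t. -/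
open scoped BigOperators ENNReal

/-- `K_t(z)`, the weighted 1-energy at time `t`: `∑_{k=1}^n (x_{v(k)} − x_k)·z^k`, where
`v(k)` is the right endpoint of the block containing index `k` (agents indexed from 0,
so agent `k` carries weight `z^(k+1)`). -/
noncomputable def TwistSystem.weighted {n : ℕ} {ρ : ℝ} {m : ℕ}
    (S : TwistSystem n ρ m) (z : ℝ) (t : ℕ) : ℝ :=
  ∑ q ∈ S.B t, ∑ k ∈ Finset.Icc q.1 q.2, (S.x t q.2 - S.x t k) * z ^ (k + 1)

/-- `𝒦(z)`: the supremum over `m`-twist systems with `x(0) ∈ [0,1]^n` of the weighted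
1-energy `K(z) = ∑_{t≥0} K_t(z)`. -/
noncomputable def maxWeightedEnergy (n : ℕ) (ρ : ℝ) (m : ℕ) (z : ℝ) : ℝ≥0∞ :=
  sSup {E | ∃ S : TwistSystem n ρ m,
    (∀ k, k < n → S.x 0 k ∈ Set.Icc (0 : ℝ) 1) ∧
    E = ∑' t : ℕ, ENNReal.ofReal (S.weighted z t)}

/-- The mirror image of a twist system. -/
noncomputable def TwistSystem.rev {n : ℕ} {ρ : ℝ} {m : ℕ}
    (S : TwistSystem n ρ m) : TwistSystem n ρ m where
  x t k := 1 - S.x t (n - 1 - k)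
  B t := (S.B t).image (fun q => (n - 1 - q.2, n - 1 - q.1))
  mono t j k hjk hk := by
    have := S.mono t (n - 1 - k) (n - 1 - j) (by omega) (by omega)
    linarith
  block_le t q hq := by
    obtain ⟨p, hp, rfl⟩ := Finset.mem_image.1 hq
    have := S.block_le t p hp
    dsimp only
    omega
  block_card t := Finset.card_image_le.trans (S.block_card t)
  partition t k hk := by
    obtain ⟨q, ⟨hq, h1, h2⟩, hu⟩ := S.partition t (n - 1 - k) (by omega)
    refine ⟨(n - 1 - q.2, n - 1 - q.1), ⟨Finset.mem_image_of_mem _ hq, ?_, ?_⟩, ?_⟩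
    · dsimp only; omega
    · dsimp only; omega
    · rintro r ⟨hr, h3, h4⟩
      obtain ⟨p, hp, rfl⟩ := Finset.mem_image.1 hr
      have hb := S.block_le t p hp
      dsimp only at h3 h4
      rw [hu p ⟨hp, by omega, by omega⟩]
  twist t r hr i h3 h4 := by
    obtain ⟨p, hp, rfl⟩ := Finset.mem_image.1 hr
    have hb := S.block_le t p hp
    dsimp only at h3 h4 ⊢
    obtain ⟨ha, hc⟩ := S.twist t p hp (n - 1 - i) (by omega) (by omega)
    have e1 : n - 1 - (n - 1 - p.2) = p.2 := by omega
    have e2 : n - 1 - (n - 1 - p.1) = p.1 := by omega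
    have e3 : n - 1 - min (i + 1) (n - 1 - p.1) = max (n - 1 - i - 1) p.1 := by omega
    have e4 : n - 1 - max (i - 1) (n - 1 - p.2) = min (n - 1 - i + 1) p.2 := by omega
    rw [e1, e2, e3, e4]
    constructor <;> linarith

lemma TwistSystem.weighted_ge {n : ℕ} {ρ : ℝ} {m : ℕ} (S : TwistSystem n ρ m) {z : ℝ}
    (hz : 1 ≤ z) (t : ℕ) (c : ℕ × ℕ → ℕ) (hc : ∀ q ∈ S.B t, q.1 ≤ c q ∧ c q ≤ q.2) :
    ∑ q ∈ S.B t, (S.x t q.2 - S.x t (c q)) * z ^ (c q + 1) ≤ S.weighted z t := by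
  unfold TwistSystem.weighted
  refine Finset.sum_le_sum fun q hq => ?_
  refine Finset.single_le_sum (f := fun k => (S.x t q.2 - S.x t k) * z ^ (k + 1)) ?_
    (Finset.mem_Icc.2 (hc q hq))
  intro k hk
  have := S.mono t k q.2 (Finset.mem_Icc.1 hk).2 (S.block_le t q hq).2
  exact mul_nonneg (by linarith) (by positivity)

lemma TwistSystem.key {n : ℕ} {ρ : ℝ} {m : ℕ} (S : TwistSystem n ρ m) {z : ℝ}
    (hz : 1 ≤ z) (hn : 2 ≤ n) (t : ℕ) :
    z ^ ((n + 1) / 2) * ∑ q ∈ S.B t, (S.x t q.2 - S.x t q.1) ≤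
      S.weighted z t + S.rev.weighted z t := by
  set N := (n + 1) / 2 with hN
  let c : ℕ × ℕ → ℕ := fun q => max q.1 (min (N - 1) q.2)
  have hc : ∀ q ∈ S.B t, q.1 ≤ c q ∧ c q ≤ q.2 := by
    intro q hq
    have := S.block_le t q hq
    simp only [c]; omega
  have h1 := S.weighted_ge hz t c hc
  have h2 : ∑ q ∈ S.B t, (S.x t (c q) - S.x t q.1) * z ^ (n - c q) ≤ S.rev.weighted z t := by
    refine le_trans (le_of_eq ?_) (S.rev.weighted_ge hz t
      (fun q => n - 1 - c (n - 1 - q.2, n - 1 - q.1)) ?_)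
    · simp only [TwistSystem.rev]
      rw [Finset.sum_image]
      · refine Finset.sum_congr rfl fun q hq => ?_
        have hb := S.block_le t q hq
        have hcq := hc q hq
        have e1 : n - 1 - (n - 1 - q.2) = q.2 := by omega
        have e2 : n - 1 - (n - 1 - q.1) = q.1 := by omega
        have e3 : n - 1 - (n - 1 - c q) = c q := by omega
        have e4 : n - 1 - c q + 1 = n - c q := by omega
        simp only [e1, e2, Prod.mk.eta, e3, e4]
        ring
      · intro p hp q hq h
        have hb := S.block_le t q hq
        have hb' := S.block_le t p hp
        simp only [Prod.mk.injEq] at h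
        ext <;> omega
    · intro r hr
      obtain ⟨q, hq, rfl⟩ := Finset.mem_image.1 hr
      have hb := S.block_le t q hq
      have hcq := hc q hq
      have e1 : n - 1 - (n - 1 - q.2) = q.2 := by omega
      have e2 : n - 1 - (n - 1 - q.1) = q.1 := by omega
      simp only [e1, e2, Prod.mk.eta]
      omega
  refine le_trans ?_ (add_le_add h1 h2)
  rw [Finset.mul_sum, ← Finset.sum_add_distrib]
  refine Finset.sum_le_sum fun q hq => ?_
  have hb := S.block_le t q hq
  have hcq := hc q hq
  have m1 := S.mono t _ _ hcq.1 (by omega)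
  have m2 := S.mono t _ _ hcq.2 (by omega)
  have a1 : z ^ N * (S.x t q.2 - S.x t (c q)) ≤ (S.x t q.2 - S.x t (c q)) * z ^ (c q + 1) := by
    by_cases h : c q = q.2
    · rw [h]; simp
    · rw [mul_comm]
      refine mul_le_mul_of_nonneg_left (pow_le_pow_right₀ hz ?_) (by linarith)
      simp only [c] at h ⊢; omega
  have a2 : z ^ N * (S.x t (c q) - S.x t q.1) ≤ (S.x t (c q) - S.x t q.1) * z ^ (n - c q) := by
    by_cases h : c q = q.1
    · rw [h]; simp
    · rw [mul_comm]
      refine mul_le_mul_of_nonneg_left (pow_le_pow_right₀ hz ?_) (by linarith)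
      simp only [c] at h ⊢; omega
  linarith

/-- For any `z ≥ 1`, the maximum 1-energy of `m`-twist systems
satisfies `𝓔^tw_{m,1} ≤ 2·z^(−ν)·𝒦(z)`, where `ν = ⌈n/2⌉`. -/
theorem maxTwistEnergy_le_weighted (n m : ℕ) (ρ z : ℝ) (hn : 2 ≤ n) (hρ0 : 0 < ρ)
    (hρ1 : ρ ≤ 1 / 2) (hm1 : 1 ≤ m) (hmn : m ≤ n - 1) (hz : 1 ≤ z) :
    maxTwistEnergy n ρ m 1 ≤
      ENNReal.ofReal (2 / z ^ ((n + 1) / 2)) * maxWeightedEnergy n ρ m z := by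
  refine sSup_le ?_
  rintro E ⟨S, hS, rfl⟩
  have hzp : 0 < z ^ ((n + 1) / 2) := by positivity
  have k1 : ∑' t : ℕ, ENNReal.ofReal (S.weighted z t) ≤ maxWeightedEnergy n ρ m z :=
    le_sSup ⟨S, hS, rfl⟩
  have k2 : ∑' t : ℕ, ENNReal.ofReal (S.rev.weighted z t) ≤ maxWeightedEnergy n ρ m z := by
    refine le_sSup ⟨S.rev, fun k hk => ?_, rfl⟩
    have := hS (n - 1 - k) (by omega)
    simp only [TwistSystem.rev, Set.mem_Icc] at this ⊢
    constructor <;> linarith [this.1, this.2]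
  have k3 : S.energy 1 ≤ ∑' t : ℕ, ENNReal.ofReal (1 / z ^ ((n + 1) / 2)) *
      (ENNReal.ofReal (S.weighted z t) + ENNReal.ofReal (S.rev.weighted z t)) := by
    unfold TwistSystem.energy
    refine ENNReal.tsum_le_tsum fun t => ?_
    simp only [Real.rpow_one]
    rw [← ENNReal.ofReal_sum_of_nonneg]
    · calc _ ≤ ENNReal.ofReal (1 / z ^ ((n + 1) / 2) *
            (S.weighted z t + S.rev.weighted z t)) := by
            apply ENNReal.ofReal_le_ofReal
            have := S.key hz hn t
            rw [one_div, inv_mul_eq_div, le_div_iff₀ hzp]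
            linarith
        _ ≤ _ := by
            rw [ENNReal.ofReal_mul (by positivity)]
            gcongr
            exact ENNReal.ofReal_add_le
    · intro q hq
      have hb := S.block_le t q hq
      have := S.mono t _ _ hb.1 hb.2
      linarith
  refine k3.trans ?_
  rw [ENNReal.tsum_mul_left, ENNReal.tsum_add]
  have e : ENNReal.ofReal (2 / z ^ ((n + 1) / 2)) =
      ENNReal.ofReal (1 / z ^ ((n + 1) / 2)) * 2 := by
    rw [← ENNReal.ofReal_ofNat 2, ← ENNReal.ofReal_mul (by positivity)]
    congr 1
    ring
  rw [e, mul_assoc, two_mul]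
  gcongr
end

section
/- Let x₁ ≤ … ≤ x_n be a sorted configuration of an m-twist system at time t and y the sorted configuration at time t+1. For any z > 1/ρ, the polynomial P_t(z) = Σ_{k=1}^n x_k·z^k satisfies P_t(z) − P_{t+1}(z) ≥ (ρ·z − 1)·K_t(z), where K_t(z) = Σ_{k=1}^n (x_{v(k)} − x_k)·z^k and v(k) is the right endpoint of the block containing index k at time t. In particular, P_t(z) is nonincreasing in t. -/
open scoped BigOperators ENNReal

/-- `P_t(z) = ∑_{k=1}^n x_k·z^k` (agents indexed from 0, so agent `k` carries weight
`z^(k+1)`). -/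
noncomputable def TwistSystem.poly {n : ℕ} {ρ : ℝ} {m : ℕ}
    (S : TwistSystem n ρ m) (z : ℝ) (t : ℕ) : ℝ :=
  ∑ k ∈ Finset.range n, S.x t k * z ^ (k + 1)

theorem TwistSystem.sum_blocks {n : ℕ} {ρ : ℝ} {m : ℕ} (S : TwistSystem n ρ m) (t : ℕ)
    (f : ℕ → ℝ) :
    ∑ k ∈ Finset.range n, f k = ∑ q ∈ S.B t, ∑ k ∈ Finset.Icc q.1 q.2, f k := by
  classical
  have h : Finset.range n = (S.B t).biUnion (fun q => Finset.Icc q.1 q.2) := by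
    ext k
    simp only [Finset.mem_range, Finset.mem_biUnion, Finset.mem_Icc]
    constructor
    · intro hk
      obtain ⟨q, hq, -⟩ := S.partition t k hk
      exact ⟨q, hq.1, hq.2⟩
    · rintro ⟨q, hq, h1, h2⟩
      have := (S.block_le t q hq).2
      omega
  rw [h, Finset.sum_biUnion]
  intro a ha b hb hab
  refine Finset.disjoint_left.2 ?_
  intro k hka hkb
  rw [Finset.mem_Icc] at hka hkb
  have hk : k < n := lt_of_le_of_lt hka.2 (S.block_le t a ha).2
  exact hab ((S.partition t k hk).unique ⟨ha, hka⟩ ⟨hb, hkb⟩)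

theorem twist_block_aux (x y : ℕ → ℝ) (ρ z : ℝ) (hρ : 0 < ρ) (hz : 0 < z) (u v : ℕ)
    (hd : x u ≤ x v)
    (hy : ∀ i, u ≤ i → i ≤ v → y i ≤ ρ * x (max (i - 1) u) + (1 - ρ) * x v)
    (w : ℕ) (hw : u ≤ w) : w ≤ v →
    (ρ * z - 1) * ∑ k ∈ Finset.Icc u w, (x v - x k) * z ^ (k + 1)
      - ρ * z * ((x v - x w) * z ^ (w + 1))
      ≤ ∑ k ∈ Finset.Icc u w, (x k - y k) * z ^ (k + 1) := by
  induction w, hw using Nat.le_induction with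
  | base =>
    intro h
    have h1 := hy u le_rfl h
    rw [max_eq_right (by omega)] at h1
    simp only [Finset.Icc_self, Finset.sum_singleton]
    have hp : 0 < z ^ (u + 1) := by positivity
    have h2 : -(x v - x u) ≤ x u - y u := by nlinarith
    nlinarith [mul_le_mul_of_nonneg_right h2 hp.le]
  | succ w hw ih =>
    intro h
    have ih := ih (by omega)
    have h1 := hy (w + 1) (by omega) h
    rw [Nat.add_sub_cancel, max_eq_left hw] at h1
    rw [← Finset.insert_Icc_right_eq_Icc_add_one (by omega),
      Finset.sum_insert (by simp), Finset.sum_insert (by simp)]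
    have hp : 0 < z ^ (w + 1 + 1) := by positivity
    have h2 : ρ * (x v - x w) - (x v - x (w + 1)) ≤ x (w + 1) - y (w + 1) := by linarith
    have h3 := mul_le_mul_of_nonneg_right h2 hp.le
    have e : z ^ (w + 1 + 1) = z * z ^ (w + 1) := by ring
    rw [e] at h3 ⊢
    generalize z ^ (w + 1) = p at *
    linarith

/-- For any `z > 1/ρ`, a step of an `m`-twist system satisfies
`P_t(z) − P_{t+1}(z) ≥ (ρ·z − 1)·K_t(z)`; in particular `P_t(z)` is nonincreasing
in `t`. -/
theorem twist_poly_decrease (n m : ℕ) (ρ : ℝ) (hn : 2 ≤ n) (hρ0 : 0 < ρ)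
    (hρ1 : ρ ≤ 1 / 2) (hm1 : 1 ≤ m) (S : TwistSystem n ρ m) (t : ℕ) (z : ℝ)
    (hz : 1 / ρ < z) :
    (ρ * z - 1) * S.weighted z t ≤ S.poly z t - S.poly z (t + 1) ∧
      S.poly z (t + 1) ≤ S.poly z t := by
  have hρz : 0 < ρ * z - 1 := by
    rw [div_lt_iff₀ hρ0] at hz
    linarith
  have hz0 : 0 < z := lt_trans (by positivity) hz
  have hK : 0 ≤ S.weighted z t := by
    unfold TwistSystem.weighted
    refine Finset.sum_nonneg fun q hq => Finset.sum_nonneg fun k hk => ?_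
    rw [Finset.mem_Icc] at hk
    have := S.mono t k q.2 hk.2 (S.block_le t q hq).2
    exact mul_nonneg (by linarith) (by positivity)
  have main : (ρ * z - 1) * S.weighted z t ≤ S.poly z t - S.poly z (t + 1) := by
    unfold TwistSystem.weighted TwistSystem.poly
    rw [← Finset.sum_sub_distrib, S.sum_blocks t, Finset.mul_sum]
    refine Finset.sum_le_sum fun q hq => ?_
    obtain ⟨h1, h2⟩ := S.block_le t q hq
    have := twist_block_aux (S.x t) (S.x (t + 1)) ρ z hρ0 hz0 q.1 q.2 (S.mono t _ _ h1 h2)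
      (fun i hi hi' => (S.twist t q hq i hi hi').2) q.2 h1 le_rfl
    simp only [sub_self, zero_mul, mul_zero, sub_zero] at this
    simpa only [sub_mul] using this
  exact ⟨main, by nlinarith [mul_nonneg hρz.le hK]⟩
end

section
/- There exist constants c > 0 and c' > 0 such that for all sufficiently small ρ > 0, all n ≥ 2, all m with 1 ≤ m ≤ n−1, and all s with 0 < s ≤ c'/(m·log(1/ρ)), the maximum s-energy of m-twist systems satisfies the lower bound 𝓔^tw_{m,s} ≥ (c/s)^m · (1/ρ)^{⌊(n+m−1)/2⌋}. -/
open scoped BigOperators ENNReal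

structure TwStep (n : ℕ) (ρ : ℝ) (m : ℕ) (x : ℕ → ℝ) (B : Finset (ℕ × ℕ)) (y : ℕ → ℝ) : Prop where
  sx : ∀ j k, j ≤ k → k < n → x j ≤ x k
  sy : ∀ j k, j ≤ k → k < n → y j ≤ y k
  block_le : ∀ q ∈ B, q.1 ≤ q.2 ∧ q.2 < n
  block_card : B.card ≤ m
  partition : ∀ k, k < n → ∃! q, q ∈ B ∧ q.1 ≤ k ∧ k ≤ q.2
  twist : ∀ q ∈ B, ∀ i, q.1 ≤ i → i ≤ q.2 →
    (1 - ρ) * x q.1 + ρ * x (min (i + 1) q.2) ≤ y i ∧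
    y i ≤ ρ * x (max (i - 1) q.1) + (1 - ρ) * x q.2

inductive TwReach (n : ℕ) (ρ : ℝ) (m : ℕ) (s : ℝ) : (ℕ → ℝ) → (ℕ → ℝ) → ℝ → Prop
  | nil (x : ℕ → ℝ) : TwReach n ρ m s x x 0
  | cons (x : ℕ → ℝ) (B : Finset (ℕ × ℕ)) (y z : ℕ → ℝ) (E : ℝ) :
      TwStep n ρ m x B y → TwReach n ρ m s y z E →
      TwReach n ρ m s x z (∑ q ∈ B, (x q.2 - x q.1) ^ s + E)

theorem TwReach.trans {n : ℕ} {ρ : ℝ} {m : ℕ} {s : ℝ} {x y z : ℕ → ℝ} {E F : ℝ}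
    (h : TwReach n ρ m s x y E) (h' : TwReach n ρ m s y z F) : TwReach n ρ m s x z (E + F) := by
  induction h with
  | nil x => simpa using h'
  | cons x B y z E hs _ ih => 
    rw [add_assoc]
    exact TwReach.cons _ _ _ _ _ hs (ih h')

theorem TwStep.hull {n : ℕ} {ρ : ℝ} {m : ℕ} {x y : ℕ → ℝ} {B : Finset (ℕ × ℕ)}
    (h0 : 0 ≤ ρ) (h1 : ρ ≤ 1) (h : TwStep n ρ m x B y) (i : ℕ) (hi : i < n) :
    y i ≤ x (n - 1) := by
  obtain ⟨q, ⟨hq, h2, h3⟩, -⟩ := h.partition i hi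
  have hb := h.block_le q hq
  have h4 := (h.twist q hq i h2 h3).2
  have h5 : x (max (i - 1) q.1) ≤ x (n - 1) := h.sx _ _ (by omega) (by omega)
  have h6 : x q.2 ≤ x (n - 1) := h.sx _ _ (by omega) (by omega)
  nlinarith [mul_le_mul_of_nonneg_left h5 h0, mul_le_mul_of_nonneg_left h6 (sub_nonneg.2 h1)]

theorem TwReach.hull {n : ℕ} {ρ : ℝ} {m : ℕ} {s : ℝ} {x z : ℕ → ℝ} {E : ℝ}
    (h0 : 0 ≤ ρ) (h1 : ρ ≤ 1) (h : TwReach n ρ m s x z E)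
    (hx : ∀ j k, j ≤ k → k < n → x j ≤ x k) (i : ℕ) (hi : i < n) : z i ≤ x (n - 1) := by
  induction h with
  | nil x => exact hx _ _ (by omega) (by omega)
  | cons x B y z E hs _ ih => 
    exact (ih hs.sy).trans (hs.hull h0 h1 _ (by omega))

theorem TwReach.affine {n : ℕ} {ρ : ℝ} {m : ℕ} {s : ℝ} {x z : ℕ → ℝ} {E : ℝ}
    (h : TwReach n ρ m s x z E) (a w : ℝ) (hw : 0 ≤ w) :
    TwReach n ρ m s (fun i => a + w * x i) (fun i => a + w * z i) (w ^ s * E) := by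
  induction h with
  | nil x => rw [mul_zero]; exact TwReach.nil _
  | cons x B y z E hs _ ih => 
    have key : TwStep n ρ m (fun i => a + w * x i) B (fun i => a + w * y i) := by
      refine ⟨fun j k hj hk => ?_, fun j k hj hk => ?_, hs.block_le, hs.block_card, hs.partition,
        fun q hq i h1 h2 => ?_⟩
      · have := mul_le_mul_of_nonneg_left (hs.sx j k hj hk) hw
        simpa using this
      · have := mul_le_mul_of_nonneg_left (hs.sy j k hj hk) hw
        simpa using this
      · obtain ⟨h3, h4⟩ := hs.twist q hq i h1 h2
        have h5 := mul_le_mul_of_nonneg_left h3 hw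
        have h6 := mul_le_mul_of_nonneg_left h4 hw
        constructor <;> linarith
    have := TwReach.cons _ _ _ _ _ key ih
    convert this using 1
    rw [mul_add, Finset.mul_sum]
    congr 1
    refine Finset.sum_congr rfl fun q hq => ?_
    have hb := hs.block_le q hq
    have := hs.sx _ _ hb.1 hb.2
    rw [← Real.mul_rpow hw (by linarith)]
    congr 1; ring

theorem TwReach.embed {n : ℕ} {ρ : ℝ} {m : ℕ} {s : ℝ} {x z : ℕ → ℝ} {E : ℝ} (hs0 : 0 < s)
    (h0 : 0 ≤ ρ) (h1 : ρ ≤ 1) (hn : 1 ≤ n)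
    (h : TwReach n ρ m s x z E) (r : ℝ) (hr : x (n - 1) ≤ r) :
    TwReach (n + 1) ρ (m + 1) s (fun i => if i < n then x i else r)
      (fun i => if i < n then z i else r) E := by
  induction h with
  | nil x => exact TwReach.nil _
  | cons x B y z E hs _ ih => 
    have hy : y (n - 1) ≤ r := (hs.hull h0 h1 _ (by omega)).trans hr
    have hnot : (n, n) ∉ B := fun hh => by have := (hs.block_le _ hh).2; simp at this
    have key : TwStep (n + 1) ρ (m + 1) (fun i => if i < n then x i else r) (insert (n, n) B)
        (fun i => if i < n then y i else r) := by
      refine ⟨fun j k hj hk => ?_, fun j k hj hk => ?_, fun q hq => ?_, ?_, fun k hk => ?_,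
        fun q hq i h2 h3 => ?_⟩
      · by_cases hkn : k < n
        · simp only [hkn, if_true, show j < n by omega]; exact hs.sx _ _ hj hkn
        · by_cases hjn : j < n
          · simp only [hkn, if_false, hjn, if_true]
            exact (hs.sx _ _ (by omega) (by omega)).trans hr
          · simp [hkn, hjn]
      · by_cases hkn : k < n
        · simp only [hkn, if_true, show j < n by omega]; exact hs.sy _ _ hj hkn
        · by_cases hjn : j < n
          · simp only [hkn, if_false, hjn, if_true]
            exact (hs.sy _ _ (by omega) (by omega)).trans hy
          · simp [hkn, hjn]
      · rcases Finset.mem_insert.1 hq with rfl | hq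
        · simp
        · have := hs.block_le q hq
          omega
      · rw [Finset.card_insert_of_notMem hnot]
        exact Nat.succ_le_succ hs.block_card
      · by_cases hkn : k < n
        · obtain ⟨q, ⟨hq, h2⟩, huniq⟩ := hs.partition k hkn
          refine ⟨q, ⟨Finset.mem_insert_of_mem hq, h2⟩, ?_⟩
          rintro q' ⟨hq', h3⟩
          rcases Finset.mem_insert.1 hq' with rfl | hq'
          · simp at h3; omega
          · exact huniq q' ⟨hq', h3⟩
        · refine ⟨(n, n), ⟨Finset.mem_insert_self _ _, by simp; omega⟩, ?_⟩
          rintro q' ⟨hq', h3⟩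
          rcases Finset.mem_insert.1 hq' with rfl | hq'
          · rfl
          · have := hs.block_le q' hq'; omega
      · rcases Finset.mem_insert.1 hq with rfl | hq
        · simp only at h2 h3
          have : i = n := by omega
          subst this
          simp
          constructor <;> linarith
        · have hb := hs.block_le q hq
          have e1 : q.1 < n := by omega
          have e2 : min (i + 1) q.2 < n := by omega
          have e3 : max (i - 1) q.1 < n := by omega
          have e4 : i < n := by omega
          simp only [hb.2, e1, e2, e3, e4, if_true]
          exact hs.twist q hq i h2 h3
    have := TwReach.cons _ _ _ _ _ key (ih hy)
    convert this using 1
    rw [Finset.sum_insert hnot]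
    simp only [sub_self, Real.zero_rpow hs0.ne', zero_add]
    congr 1
    refine Finset.sum_congr rfl fun q hq => ?_
    have hb := hs.block_le q hq
    simp only [hb.2, if_true, show q.1 < n by omega]

theorem TwReach.toSystem {n : ℕ} {ρ : ℝ} {m : ℕ} {s : ℝ} {x z : ℕ → ℝ} {E : ℝ}
    (hn : 1 ≤ n) (hm : 1 ≤ m)
    (h : TwReach n ρ m s x z E) (hz : ∀ i < n, z i = z 0) :
    ∃ S : TwistSystem n ρ m, S.x 0 = x ∧ ENNReal.ofReal E ≤ S.energy s := by
  induction h with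
  | nil x =>
    refine ⟨⟨fun _ => x, fun _ => {(0, n - 1)}, ?_, ?_, ?_, ?_, ?_⟩, rfl, by simp⟩
    · intro t j k hj hk
      rw [hz j (by omega), hz k hk]
    · intro t q hq
      rw [Finset.mem_singleton] at hq; subst hq; simp; omega
    · intro t; simpa using hm
    · intro t k hk
      refine ⟨(0, n - 1), ⟨by simp, by simp, by simp; omega⟩, ?_⟩
      rintro q ⟨hq, -⟩
      simpa using hq
    · intro t q hq i h1 h2
      rw [Finset.mem_singleton] at hq; subst hq; simp only at h1 h2 ⊢
      rw [hz (min (i + 1) (n - 1)) (by omega), hz i (by omega), hz (max (i - 1) 0) (by omega),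
        hz (n - 1) (by omega)]
      constructor <;> linarith
  | cons x B y z E hs _ ih =>
    obtain ⟨S, hS, hE⟩ := ih hz
    refine ⟨⟨fun t => Nat.casesOn t x S.x, fun t => Nat.casesOn t B S.B, ?_, ?_, ?_, ?_, ?_⟩, 
      rfl, ?_⟩
    · intro t; cases t
      · exact hs.sx
      · exact S.mono _
    · intro t; cases t
      · exact hs.block_le
      · exact S.block_le _
    · intro t; cases t
      · exact hs.block_card
      · exact S.block_card _
    · intro t; cases t
      · exact hs.partition
      · exact S.partition _
    · intro t; cases t
      · have := hs.twist
        rw [← hS] at this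
        exact this
      · exact S.twist _
    · unfold TwistSystem.energy
      rw [tsum_eq_zero_add' ENNReal.summable]
      refine ENNReal.ofReal_add_le.trans (add_le_add ?_ hE)
      rw [ENNReal.ofReal_sum_of_nonneg]
      · exact le_rfl
      intro q hq
      have hb := hs.block_le q hq
      have := hs.sx _ _ hb.1 hb.2
      exact Real.rpow_nonneg (by linarith) _

/-- one block -/
theorem TwReach.one {n : ℕ} {ρ : ℝ} {m : ℕ} {s : ℝ} {x y z : ℕ → ℝ} {E : ℝ}
    (hn : 1 ≤ n) (hm : 1 ≤ m)
    (sx : ∀ j k, j ≤ k → k < n → x j ≤ x k)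
    (sy : ∀ j k, j ≤ k → k < n → y j ≤ y k)
    (tw : ∀ i, i < n → (1 - ρ) * x 0 + ρ * x (min (i + 1) (n - 1)) ≤ y i ∧
      y i ≤ ρ * x (i - 1) + (1 - ρ) * x (n - 1))
    (h : TwReach n ρ m s y z E) :
    TwReach n ρ m s x z ((x (n - 1) - x 0) ^ s + E) := by
  have key : TwStep n ρ m x {(0, n - 1)} y := by
    refine ⟨sx, sy, ?_, by simpa using hm, ?_, ?_⟩
    · intro q hq
      rw [Finset.mem_singleton] at hq; subst hq; simp; omega
    · intro k hk
      refine ⟨(0, n - 1), ⟨by simp, by simp, by simp; omega⟩, ?_⟩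
      rintro q ⟨hq, -⟩
      simpa using hq
    · intro q hq i h1 h2
      rw [Finset.mem_singleton] at hq; subst hq; simp only at h1 h2 ⊢
      have := tw i (by omega)
      simpa using this
  have := TwReach.cons _ _ _ _ _ key h
  simpa using this

theorem TwReach.collapse {n : ℕ} {ρ : ℝ} {m : ℕ} {s : ℝ} {x : ℕ → ℝ} 
    (h0 : 0 ≤ ρ) (h1 : ρ ≤ 1 / 2) (hn : 1 ≤ n) (hm : 1 ≤ m)
    (sx : ∀ j k, j ≤ k → k < n → x j ≤ x k) :
    ∃ z E, TwReach n ρ m s x z E ∧ (∀ i < n, z i = z 0) ∧ 0 ≤ E := by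
  refine ⟨fun _ => (x 0 + x (n - 1)) / 2, _, TwReach.one hn hm sx (fun _ _ _ _ => le_rfl) ?_
    (TwReach.nil _), fun _ _ => rfl, ?_⟩
  · intro i hi
    have a1 : x (min (i + 1) (n - 1)) ≤ x (n - 1) := sx _ _ (by omega) (by omega)
    have a2 : x 0 ≤ x (i - 1) := sx _ _ (by omega) (by omega)
    have a3 : x 0 ≤ x (n - 1) := sx _ _ (by omega) (by omega)
    have := mul_le_mul_of_nonneg_left a1 h0
    have := mul_le_mul_of_nonneg_left a2 h0
    constructor <;> nlinarith
  · have a3 : x 0 ≤ x (n - 1) := sx _ _ (by omega) (by omega)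
    have := Real.rpow_nonneg (sub_nonneg.2 a3) s
    linarith

theorem tw_geom (u s : ℝ) (hu : 0 < u) (hu' : u ≤ 1 / 2) (hs : 0 < s) :
    ∃ T : ℕ, 1 / (4 * s * u) ≤ ∑ t ∈ Finset.range T, ((1 - u) ^ s) ^ t := by
  have hpos : (0 : ℝ) < 1 - u := by linarith
  set μ := (1 - u) ^ s with hμ
  have hμ0 : 0 < μ := Real.rpow_pos_of_pos hpos s
  have hμ1 : μ < 1 := Real.rpow_lt_one hpos.le (by linarith) hs
  have hb : 1 - μ ≤ 2 * s * u := by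
    have h1 : 1 - (1 - u)⁻¹ ≤ Real.log (1 - u) := Real.one_sub_inv_le_log_of_pos hpos
    have h2 : (1 - u)⁻¹ ≤ 1 + 2 * u := by
      rw [inv_le_iff_one_le_mul₀ hpos]; nlinarith
    have h3 : μ = Real.exp (Real.log (1 - u) * s) := Real.rpow_def_of_pos hpos s
    have h4 := Real.add_one_le_exp (Real.log (1 - u) * s)
    rw [← h3] at h4
    nlinarith
  obtain ⟨T, hT⟩ := exists_pow_lt_of_lt_one (show (0:ℝ) < 1 / 2 by norm_num) hμ1
  refine ⟨T, ?_⟩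
  rw [geom_sum_eq hμ1.ne, ← neg_div_neg_eq (μ ^ T - 1), neg_sub, neg_sub, div_le_div_iff₀ (by positivity) (by linarith)]
  have : 0 < s * u := by positivity
  nlinarith

/-- energy `E` is attainable from a normalized configuration by a run that collapses -/
def TwP (n : ℕ) (ρ : ℝ) (m : ℕ) (s E : ℝ) : Prop :=
  ∃ x z : ℕ → ℝ, ∃ E' : ℝ, x 0 = 0 ∧ x (n - 1) = 1 ∧ (∀ j k, j ≤ k → k < n → x j ≤ x k) ∧
    TwReach n ρ m s x z E' ∧ (∀ i < n, z i = z 0) ∧ E ≤ E'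

theorem tw_phases {n : ℕ} {ρ : ℝ} {m : ℕ} {s E : ℝ} (hs0 : 0 < s)
    (h0 : 0 < ρ) (h1 : ρ ≤ 1 / 4) (hn : 1 ≤ n) (hE : 0 ≤ E) (h : TwP n ρ m s E) (J : ℕ) :
    ∀ p r : ℝ, p < r → ∃ z E', TwReach (n + 1) ρ (m + 1) s (fun i => if i < n then p else r) z E' ∧
      (∀ i < n + 1, z i = z 0) ∧
      E * ρ ^ s * (r - p) ^ s * ∑ j ∈ Finset.range J, ((1 - 2 * ρ) ^ s) ^ j ≤ E' := by
  obtain ⟨x, z, E₀, hx0, hx1, hxs, hR, hz, hEE⟩ := h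
  have sconf : ∀ p r : ℝ, p ≤ r → ∀ j k, j ≤ k → k < n + 1 →
      (fun i => if i < n then p else r) j ≤ (fun i => if i < n then p else r) k := by
    intro p r hpr j k hj hk
    simp only
    split_ifs
    · exact le_rfl
    · exact hpr
    · omega
    · exact le_rfl
  induction J with
  | zero =>
    intro p r hpr
    obtain ⟨z, E', ha, hb, hc⟩ := TwReach.collapse (s := s) (m := m + 1) h0.le (by linarith)
      (by omega : 1 ≤ n + 1) (by omega) (sconf p r hpr.le)
    exact ⟨z, E', ha, hb, by simpa using hc⟩
  | succ J ih =>
    intro p r hpr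
    set L := r - p with hL
    have hLp : 0 < L := by linarith
    have hw : 0 ≤ ρ * L := by positivity
    have hρL : ρ * L ≤ 1 / 4 * L := mul_le_mul_of_nonneg_right h1 hLp.le
    have hA := hR.affine p (ρ * L) hw
    have sA : ∀ j k, j ≤ k → k < n → (fun i => p + ρ * L * x i) j ≤ (fun i => p + ρ * L * x i) k := by
      intro j k hj hk
      have := mul_le_mul_of_nonneg_left (hxs j k hj hk) hw
      simpa using this
    have hhull := hA.hull h0.le (by linarith) sA 0 (by omega)
    simp only [hx1, mul_one] at hhull
    have hB := hA.embed hs0 h0.le (by linarith) hn (r - ρ * L) (by simp only [hx1]; linarith)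
    set p' := p + ρ * L * z 0 with hp'
    have hconf : (fun i => if i < n then p + ρ * L * z i else r - ρ * L) =
        (fun i => if i < n then p' else r - ρ * L) := by
      funext i
      split_ifs with hi
      · rw [hz i hi]
      · rfl
    simp only [hconf] at hB
    obtain ⟨z', E', ha, hb, hc⟩ := ih p' (r - ρ * L) (by linarith)
    have hbig := hB.trans ha
    have hfirst := TwReach.one (x := fun i => if i < n then p else r) (by omega : 1 ≤ n + 1)
      (by omega) (sconf p r hpr.le) (y := fun i => if i < n then p + ρ * L * x i else r - ρ * L) 
      ?_ ?_ hbig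
    · refine ⟨z', _, hfirst, hb, ?_⟩
      have hnn : 0 ≤ ((fun i => if i < n then p else r) (n + 1 - 1) - 
          (fun i => if i < n then p else r) 0) ^ s := by
        apply Real.rpow_nonneg
        simp [show 0 < n by omega]; linarith
      have hL' : (1 - 2 * ρ) * L ≤ r - ρ * L - p' := by nlinarith
      have hpow : (1 - 2 * ρ) ^ s * L ^ s ≤ (r - ρ * L - p') ^ s := by
        rw [← Real.mul_rpow (by linarith) hLp.le]
        exact Real.rpow_le_rpow (mul_nonneg (by linarith) hLp.le) hL' hs0.le
      have hμ : 0 ≤ (1 - 2 * ρ) ^ s := Real.rpow_nonneg (by linarith) s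
      have hρs : 0 ≤ ρ ^ s := Real.rpow_nonneg h0.le s
      have hLs : 0 ≤ L ^ s := Real.rpow_nonneg hLp.le s
      rw [Finset.sum_range_succ']
      simp only [pow_succ, pow_zero, ← Finset.sum_mul]
      set G := ∑ j ∈ Finset.range J, ((1 - 2 * ρ) ^ s) ^ j with hG
      have hG0 : 0 ≤ G := Finset.sum_nonneg fun j _ => pow_nonneg hμ j
      have e1 : (ρ * L) ^ s = ρ ^ s * L ^ s := Real.mul_rpow h0.le hLp.le
      rw [e1]
      have e2 : ρ ^ s * L ^ s * E ≤ ρ ^ s * L ^ s * E₀ :=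
        mul_le_mul_of_nonneg_left hEE (by positivity)
      have e3 : E * ρ ^ s * ((1 - 2 * ρ) ^ s * L ^ s) * G ≤ 
          E * ρ ^ s * ((r - ρ * L - p') ^ s) * G := by gcongr
      nlinarith
    · intro j k hj hk
      by_cases hkn : k < n
      · simp only [hkn, if_true, show j < n by omega]; exact sA _ _ hj hkn
      · by_cases hjn : j < n
        · simp only [hkn, if_false, hjn, if_true]
          have := sA j (n - 1) (by omega) (by omega)
          simp only [hx1] at this
          linarith
        · simp [hkn, hjn]
    · intro i hi
      have c1 : i - 1 < n := by omega
      have c2 : 0 < n := by omega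
      simp only [Nat.add_sub_cancel, c1, c2, lt_irrefl, if_true, if_false]
      by_cases hin : i < n
      · have hxi : 0 ≤ x i := by rw [← hx0]; exact hxs _ _ (by omega) hin
        have hxi1 : x i ≤ 1 := by rw [← hx1]; exact hxs _ _ (by omega) (by omega)
        have q1 := mul_nonneg hw hxi
        have q2 := mul_le_mul_of_nonneg_left hxi1 hw
        simp only [hin, if_true]
        by_cases hin1 : min (i + 1) n < n
        · simp only [hin1, if_true]
          constructor <;> nlinarith
        · have : i = n - 1 := by omega
          subst this
          simp only [hin1, if_false, hx1]
          constructor <;> nlinarith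
      · simp only [hin, if_false, show ¬ (min (i + 1) n < n) by omega]
        constructor <;> nlinarith

theorem tw_succ {n : ℕ} {ρ : ℝ} {m : ℕ} {s E : ℝ} (hs0 : 0 < s)
    (h0 : 0 < ρ) (h1 : ρ ≤ 1 / 4) (hn : 1 ≤ n) (hE : 0 ≤ E) (h : TwP n ρ m s E) :
    TwP (n + 1) ρ (m + 1) s (E * ρ ^ s * (1 / (8 * s * ρ))) := by
  obtain ⟨J, hJ⟩ := tw_geom (2 * ρ) s (by linarith) (by linarith) hs0
  obtain ⟨z, E', ha, hb, hc⟩ := tw_phases hs0 h0 h1 hn hE h J 0 1 one_pos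
  refine ⟨_, z, E', ?_, ?_, ?_, ha, hb, le_trans ?_ hc⟩
  · simp; omega
  · simp
  · intro j k hj hk
    split_ifs <;> first | omega | norm_num
  · rw [sub_zero, Real.one_rpow, mul_one]
    refine mul_le_mul_of_nonneg_left (le_trans (le_of_eq ?_) hJ)
      (mul_nonneg hE (Real.rpow_nonneg h0.le s))
    congr 1; ring

/-- left-half offsets -/
noncomputable def twg (ρ : ℝ) (k i : ℕ) : ℝ := if i = 0 then 0 else ρ ^ (k - i)

/-- base shape -/
noncomputable def twh (ρ : ℝ) (N i : ℕ) : ℝ :=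
  if i < N / 2 then -(1 / 2) + twg ρ (N / 2) i
  else if N ≤ i + N / 2 then 1 / 2 - twg ρ (N / 2) (N - 1 - i) else 0

theorem twg_bd {ρ : ℝ} (h0 : 0 < ρ) (h1 : ρ ≤ 1 / 4) (k i : ℕ) (hi : i < k) :
    0 ≤ twg ρ k i ∧ twg ρ k i ≤ 1 / 4 := by
  unfold twg
  split_ifs
  · norm_num
  · refine ⟨by positivity, le_trans ?_ h1⟩
    have := pow_le_pow_of_le_one h0.le (by linarith) (show 1 ≤ k - i by omega)
    simpa using this

theorem twg_mono {ρ : ℝ} (h0 : 0 < ρ) (h1 : ρ ≤ 1 / 4) (k i j : ℕ) (hij : i ≤ j) :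
    twg ρ k i ≤ twg ρ k j := by
  unfold twg
  split_ifs
  · norm_num
  · positivity
  · omega
  · exact pow_le_pow_of_le_one h0.le (by linarith) (by omega)

theorem twh_mono {ρ : ℝ} (h0 : 0 < ρ) (h1 : ρ ≤ 1 / 4) (N i j : ℕ) (hij : i ≤ j) (hj : j < N) :
    twh ρ N i ≤ twh ρ N j := by
  unfold twh
  split_ifs with a b c d e f g <;> try omega
  · linarith [twg_mono h0 h1 (N / 2) i j hij]
  · linarith [twg_bd h0 h1 (N / 2) i a, twg_bd h0 h1 (N / 2) (N - 1 - j) (by omega)]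
  · linarith [twg_bd h0 h1 (N / 2) i a]
  · linarith [twg_mono h0 h1 (N / 2) (N - 1 - j) (N - 1 - i) (by omega)]
  · linarith [twg_bd h0 h1 (N / 2) (N - 1 - j) (by omega)]
  · exact le_rfl

theorem twh_symm {ρ : ℝ} (N i : ℕ) (hi : i < N) :
    twh ρ N (N - 1 - i) = - twh ρ N i := by
  unfold twh
  split_ifs <;> try omega
  · ring
  · rw [show N - 1 - (N - 1 - i) = i by omega]; ring
  · ring

theorem twh_zero {ρ : ℝ} (N : ℕ) (hN : 2 ≤ N) : twh ρ N 0 = -(1 / 2) := by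
  simp [twh, twg, show 0 < N / 2 by omega]

theorem twh_low {ρ : ℝ} (h0 : 0 < ρ) (h1 : ρ ≤ 1 / 4) (N i : ℕ) (hN : 2 ≤ N) (hi : i < N) :
    (1 - ρ) * twh ρ N 0 + ρ * twh ρ N (min (i + 1) (N - 1)) ≤
      (1 - 2 * ρ ^ (N / 2)) * twh ρ N i := by
  have hz := twh_zero (ρ := ρ) N hN
  have hlast : twh ρ N (N - 1) = 1 / 2 := by
    have := twh_symm (ρ := ρ) N 0 (by omega)
    rw [hz] at this; simpa using this
  have hub : twh ρ N (min (i + 1) (N - 1)) ≤ 1 / 2 := by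
    rw [← hlast]; exact twh_mono h0 h1 N _ _ (by omega) (by omega)
  have hk0 : 0 < ρ ^ (N / 2) := by positivity
  have hk1 : ρ ^ (N / 2) ≤ ρ := by
    have := pow_le_pow_of_le_one h0.le (by linarith) (show 1 ≤ N / 2 by omega)
    simpa using this
  rw [hz]
  by_cases hik : i < N / 2
  · have hhi : twh ρ N i = -(1 / 2) + twg ρ (N / 2) i := by simp [twh, hik]
    have hg := twg_bd h0 h1 (N / 2) i hik
    have hkey : ρ * (twh ρ N (min (i + 1) (N - 1)) + 1 / 2) ≤ 
        (if i = 0 then ρ ^ (N / 2) else twg ρ (N / 2) i) := by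
      by_cases hik1 : i + 1 < N / 2
      · rw [show min (i + 1) (N - 1) = i + 1 by omega]
        have : twh ρ N (i + 1) + 1 / 2 = ρ ^ (N / 2 - (i + 1)) := by
          simp [twh, hik1, twg]
        rw [this, ← pow_succ']
        split_ifs with hi0
        · subst hi0; rw [show N / 2 - (0 + 1) + 1 = N / 2 by omega]
        · simp only [twg, hi0, if_false]
          rw [show N / 2 - (i + 1) + 1 = N / 2 - i by omega]
      · have : (if i = 0 then ρ ^ (N / 2) else twg ρ (N / 2) i) = ρ := by
          split_ifs with hi0
          · rw [show N / 2 = 1 by omega, pow_one]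
          · simp only [twg, hi0, if_false]
            rw [show N / 2 - i = 1 by omega, pow_one]
        rw [this]
        nlinarith
    rw [hhi]
    split_ifs at hkey with hi0
    · have : twg ρ (N / 2) i = 0 := by simp [twg, hi0]
      rw [this]; linarith
    · nlinarith
  · have : 0 ≤ twh ρ N i := by
      simp only [twh, hik, if_false]
      split_ifs
      · linarith [twg_bd h0 h1 (N / 2) (N - 1 - i) (by omega)]
      · exact le_rfl
    have := mul_nonneg (show 0 ≤ 1 - 2 * ρ ^ (N / 2) by linarith) this
    nlinarith

theorem twh_high {ρ : ℝ} (h0 : 0 < ρ) (h1 : ρ ≤ 1 / 4) (N i : ℕ) (hN : 2 ≤ N) (hi : i < N) :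
    (1 - 2 * ρ ^ (N / 2)) * twh ρ N i ≤ ρ * twh ρ N (i - 1) + (1 - ρ) * twh ρ N (N - 1) := by
  have h := twh_low h0 h1 N (N - 1 - i) hN (by omega)
  rw [twh_symm N i hi] at h
  have e1 : twh ρ N (N - 1) = - twh ρ N 0 := by
    have := twh_symm (ρ := ρ) N 0 (by omega)
    simpa using this
  have e2 : twh ρ N (min (N - 1 - i + 1) (N - 1)) = - twh ρ N (i - 1) := by
    rw [← twh_symm N (i - 1) (by omega)]
    congr 1; omega
  rw [e2] at h
  rw [e1]; linarith

theorem tw_base_run {ρ s : ℝ} (h0 : 0 < ρ) (h1 : ρ ≤ 1 / 4) (N : ℕ) (hN : 2 ≤ N) (T : ℕ) :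
    ∀ D : ℝ, 0 < D → ∃ z E', TwReach N ρ 1 s (fun i => D * twh ρ N i) z E' ∧
      (∀ i < N, z i = z 0) ∧
      D ^ s * ∑ t ∈ Finset.range T, ((1 - 2 * ρ ^ (N / 2)) ^ s) ^ t ≤ E' := by
  have sD : ∀ D : ℝ, 0 < D → ∀ j k, j ≤ k → k < N → 
      (fun i => D * twh ρ N i) j ≤ (fun i => D * twh ρ N i) k := fun D hD j k hj hk =>
    mul_le_mul_of_nonneg_left (twh_mono h0 h1 N j k hj hk) hD.le
  have hk1 : ρ ^ (N / 2) ≤ ρ := by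
    have := pow_le_pow_of_le_one h0.le (by linarith) (show 1 ≤ N / 2 by omega)
    simpa using this
  have hlam : 0 < 1 - 2 * ρ ^ (N / 2) := by linarith
  have hz := twh_zero (ρ := ρ) N hN
  have hlast : twh ρ N (N - 1) = 1 / 2 := by
    have := twh_symm (ρ := ρ) N 0 (by omega)
    rw [hz] at this; simpa using this
  induction T with
  | zero =>
    intro D hD
    obtain ⟨z, E', ha, hb, hc⟩ := TwReach.collapse (s := s) (m := 1) h0.le (by linarith)
      (by omega : 1 ≤ N) le_rfl (sD D hD)
    exact ⟨z, E', ha, hb, by simpa using hc⟩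
  | succ T ih =>
    intro D hD
    have hD' : 0 < D * (1 - 2 * ρ ^ (N / 2)) := by positivity
    obtain ⟨z, E', ha, hb, hc⟩ := ih _ hD'
    refine ⟨z, _, TwReach.one (by omega) le_rfl (sD D hD) (sD _ hD') ?_ ha, hb, ?_⟩
    · intro i hi
      have q1 := mul_le_mul_of_nonneg_left (twh_low h0 h1 N i hN hi) hD.le
      have q2 := mul_le_mul_of_nonneg_left (twh_high h0 h1 N i hN hi) hD.le
      constructor <;> linarith
    · rw [hz, hlast, show D * (1 / 2) - D * -(1 / 2) = D by ring]
      rw [Real.mul_rpow hD.le hlam.le] at hc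
      rw [Finset.sum_range_succ']
      simp only [pow_succ, pow_zero, ← Finset.sum_mul]
      linarith

theorem tw_base {ρ s : ℝ} (hs0 : 0 < s) (h0 : 0 < ρ) (h1 : ρ ≤ 1 / 4) (N : ℕ) (hN : 2 ≤ N) :
    TwP N ρ 1 s (1 / (8 * s * ρ ^ (N / 2))) := by
  have hk1 : ρ ^ (N / 2) ≤ ρ := by
    have := pow_le_pow_of_le_one h0.le (by linarith) (show 1 ≤ N / 2 by omega)
    simpa using this
  obtain ⟨T, hT⟩ := tw_geom (2 * ρ ^ (N / 2)) s (by positivity) (by linarith) hs0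
  obtain ⟨z, E', ha, hb, hc⟩ := tw_base_run (s := s) h0 h1 N hN T 1 one_pos
  have hz := twh_zero (ρ := ρ) N hN
  have hlast : twh ρ N (N - 1) = 1 / 2 := by
    have := twh_symm (ρ := ρ) N 0 (by omega)
    rw [hz] at this; simpa using this
  have hA := ha.affine (1 / 2) 1 zero_le_one
  refine ⟨_, _, _, ?_, ?_, ?_, hA, ?_, ?_⟩
  · simp only [hz]; norm_num
  · simp only [hlast]; norm_num
  · intro j k hj hk
    have := twh_mono h0 h1 N j k hj hk
    linarith
  · intro i hi
    simp only [hb i hi]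
  · rw [Real.one_rpow, one_mul] at hc ⊢
    refine le_trans (le_of_eq ?_) (hT.trans hc)
    congr 1; ring

theorem tw_all {ρ s : ℝ} (hs0 : 0 < s) (h0 : 0 < ρ) (h1 : ρ ≤ 1 / 4) (hρs : 1 / 4 ≤ ρ ^ s)
    (N : ℕ) (hN : 2 ≤ N) (j : ℕ) :
    TwP (N + j) ρ (1 + j) s ((1 / 32 / s) ^ (j + 1) * (1 / ρ) ^ (N / 2 + j)) := by
  have weaken : ∀ n m E F, F ≤ E → TwP n ρ m s E → TwP n ρ m s F := by
    rintro n m E F hF ⟨x, z, E', a, b, c, d, e, f⟩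
    exact ⟨x, z, E', a, b, c, d, e, hF.trans f⟩
  induction j with
  | zero =>
    refine weaken _ _ _ _ ?_ (tw_base hs0 h0 h1 N hN)
    have e : 1 / (8 * s * ρ ^ (N / 2)) = 4 * ((1 / 32 / s) ^ (0 + 1) * (1 / ρ) ^ (N / 2 + 0)) := by
      rw [zero_add, add_zero, pow_one, one_div_pow]
      field_simp
      norm_num
    rw [e]
    have : 0 < (1 / 32 / s) ^ (0 + 1) * (1 / ρ) ^ (N / 2 + 0) := by positivity
    linarith
  | succ j ih =>
    have h := tw_succ hs0 h0 h1 (by omega) (by positivity) ih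
    refine weaken _ _ _ _ ?_ h
    set A := (1 / 32 / s) ^ (j + 1) * (1 / ρ) ^ (N / 2 + j) with hA
    have hA0 : 0 < A := by positivity
    have e : (1 / 32 / s) ^ (j + 1 + 1) * (1 / ρ) ^ (N / 2 + (j + 1)) = 
        A * (1 / 4) * (1 / (8 * s * ρ)) := by
      rw [hA, ← add_assoc, pow_succ _ (j + 1), pow_succ _ (N / 2 + j)]
      field_simp
      norm_num
    rw [e]
    gcongr

/-- There exist constants `c > 0` and `c' > 0` such that for all
sufficiently small `ρ > 0`, all `n ≥ 2`, all `m` with `1 ≤ m ≤ n−1`, and all `s` with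
`0 < s ≤ c'/(m·log(1/ρ))`, the maximum `s`-energy of `m`-twist systems satisfies the
lower bound `𝓔^tw_{m,s} ≥ (c/s)^m · (1/ρ)^⌊(n+m−1)/2⌋`. -/
theorem maxTwistEnergy_lower_bound :
    ∃ c : ℝ, 0 < c ∧ ∃ c' : ℝ, 0 < c' ∧ ∃ ρ₀ : ℝ, 0 < ρ₀ ∧
      ∀ ρ : ℝ, 0 < ρ → ρ ≤ ρ₀ →
        ∀ n m : ℕ, 2 ≤ n → 1 ≤ m → m ≤ n - 1 →
          ∀ s : ℝ, 0 < s → s ≤ c' / (m * Real.log (1 / ρ)) →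
            ENNReal.ofReal ((c / s) ^ m * (1 / ρ) ^ ((n + m - 1) / 2)) ≤
              maxTwistEnergy n ρ m s := by
  refine ⟨1 / 32, by norm_num, 1, one_pos, 1 / 4, by norm_num, ?_⟩
  intro ρ h0 h1 n m hn hm hmn s hs hs'
  have hlog : 0 < Real.log (1 / ρ) := Real.log_pos (by rw [lt_div_iff₀ h0]; linarith)
  have hm1 : (1 : ℝ) ≤ m := by exact_mod_cast hm
  have hsl : s * Real.log (1 / ρ) ≤ 1 := by
    rw [le_div_iff₀ (by positivity)] at hs'
    have : 0 < s * Real.log (1 / ρ) := by positivity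
    nlinarith
  have hρs : 1 / 4 ≤ ρ ^ s := by
    rw [one_div, Real.log_inv] at hsl
    have h3 : ρ ^ s = Real.exp (Real.log ρ * s) := Real.rpow_def_of_pos h0 s
    have h4 : Real.exp (-1) ≤ ρ ^ s := by
      rw [h3]; exact Real.exp_le_exp.2 (by linarith)
    have h5 : Real.exp 1 < 4 := by linarith [Real.exp_one_lt_d9]
    have h6 : (1 : ℝ) / 4 ≤ Real.exp (-1) := by
      rw [Real.exp_neg, one_div]
      exact inv_anti₀ (Real.exp_pos _) h5.le
    linarith
  obtain ⟨j, rfl⟩ : ∃ j, m = 1 + j := ⟨m - 1, by omega⟩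
  obtain ⟨N, rfl⟩ : ∃ N, n = N + j := ⟨n - j, by omega⟩
  have hN : 2 ≤ N := by omega
  obtain ⟨x, z, E', hx0, hx1, hxs, hR, hz, hE⟩ := tw_all hs h0 h1 hρs N hN j
  obtain ⟨S, hS, hSE⟩ := hR.toSystem (by omega) (by omega) hz
  rw [show (N + j + (1 + j) - 1) / 2 = N / 2 + j by omega]
  rw [add_comm j 1] at hE
  refine (ENNReal.ofReal_le_ofReal hE).trans (hSE.trans (le_sSup ⟨S, ?_, rfl⟩))
  intro k hk
  rw [hS]
  constructor
  · rw [← hx0]; exact hxs _ _ (by omega) hk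
  · rw [← hx1]; exact hxs _ _ (by omega) (by omega)
end

section
/- Let M be a symmetric nonnegative n×n matrix with positive diagonal whose nonzero entries are all at least 1, let q = M·𝟏 (so q_i > 0), and let P = diag(q)^{-1} M. Then for every x ∈ ℝ^n, ‖Px‖_q² ≤ ‖x‖_q² − D/2, where ‖y‖_q² = Σ_i q_i y_i² and D = Σ_i max{ (x_i − x_j)² : j with M_{ij} > 0 }. -/
open scoped BigOperators

/-- Let `M` be a symmetric nonnegative `n×n` matrix with positive
diagonal whose nonzero entries are all at least `1`, let `q = M·𝟏`, and let
`P = diag(q)⁻¹·M`.  Then for every `x ∈ ℝⁿ`, `‖Px‖_q² ≤ ‖x‖_q² − D/2`, where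
`‖y‖_q² = ∑ i, q i * y i ^ 2` and `D = ∑ i, max {(x i − x j)² : M i j ≠ 0}`. -/
theorem dirichlet_contraction (n : ℕ) (M : Matrix (Fin n) (Fin n) ℝ)
    (hsymm : ∀ i j, M i j = M j i)
    (hnonneg : ∀ i j, 0 ≤ M i j)
    (hdiag : ∀ i, 0 < M i i)
    (hone : ∀ i j, M i j ≠ 0 → 1 ≤ M i j)
    (q : Fin n → ℝ) (hq : ∀ i, q i = ∑ j, M i j)
    (P : Matrix (Fin n) (Fin n) ℝ) (hP : ∀ i j, P i j = M i j / q i)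
    (x : Fin n → ℝ) :
    ∑ i, q i * (P.mulVec x i) ^ 2 ≤
      ∑ i, q i * (x i) ^ 2 -
        (∑ i, ⨆ j : {j : Fin n // M i j ≠ 0}, (x i - x (j : Fin n)) ^ 2) / 2 := by
  have hq0 : ∀ i, 0 < q i := by
    intro i
    rw [hq]
    exact lt_of_lt_of_le (hdiag i)
      (Finset.single_le_sum (f := fun j => M i j) (fun j _ => hnonneg i j) (Finset.mem_univ i))
  have key : ∀ i, q i * (P.mulVec x i) ^ 2 +
      (⨆ j : {j : Fin n // M i j ≠ 0}, (x i - x (j : Fin n)) ^ 2) / 2 ≤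
      ∑ j, M i j * x j ^ 2 := by
    intro i
    have hm : q i * P.mulVec x i = ∑ j, M i j * x j := by
      simp only [Matrix.mulVec, dotProduct, hP, Finset.mul_sum]
      refine Finset.sum_congr rfl fun j _ => ?_
      have := (hq0 i).ne'
      field_simp
    generalize P.mulVec x i = m at hm ⊢
    have hvar : ∑ j, M i j * (x j - m) ^ 2 = ∑ j, M i j * x j ^ 2 - q i * m ^ 2 := by
      have e : ∀ j, M i j * (x j - m) ^ 2 =
          M i j * x j ^ 2 - 2 * m * (M i j * x j) + m ^ 2 * M i j := fun j => by ring
      simp only [e, Finset.sum_add_distrib, Finset.sum_sub_distrib, ← Finset.mul_sum]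
      rw [← hm, ← hq]
      ring
    have hnn : ∀ j, 0 ≤ M i j * (x j - m) ^ 2 := fun j => mul_nonneg (hnonneg i j) (sq_nonneg _)
    haveI : Nonempty {j : Fin n // M i j ≠ 0} := ⟨⟨i, (hdiag i).ne'⟩⟩
    have hsup : (⨆ j : {j : Fin n // M i j ≠ 0}, (x i - x (j : Fin n)) ^ 2) ≤
        2 * ∑ j, M i j * (x j - m) ^ 2 := by
      refine ciSup_le ?_
      rintro ⟨j, hj⟩
      by_cases hij : i = j
      · subst hij
        have := Finset.sum_nonneg (s := Finset.univ) (fun j _ => hnn j)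
        simpa using this
      · have h1 := Finset.sum_le_sum_of_subset_of_nonneg (Finset.subset_univ ({i, j} : Finset (Fin n)))
          (fun k _ _ => hnn k)
        rw [Finset.sum_pair hij] at h1
        have a := mul_le_mul_of_nonneg_right (hone i i (hdiag i).ne') (sq_nonneg (x i - m))
        have b := mul_le_mul_of_nonneg_right (hone i j hj) (sq_nonneg (x j - m))
        have c := sq_nonneg ((x i - m) + (x j - m))
        dsimp only
        nlinarith
    linarith
  have hs : ∑ i, ∑ j, M i j * x j ^ 2 = ∑ i, q i * x i ^ 2 := by
    rw [Finset.sum_comm]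
    refine Finset.sum_congr rfl fun j _ => ?_
    rw [← Finset.sum_mul, hq]
    simp only [fun k => hsymm k j]
  have := Finset.sum_le_sum (s := Finset.univ) (fun i _ => key i)
  rw [Finset.sum_add_distrib, ← Finset.sum_div, hs] at this
  linarith
end

section
/- There is an absolute constant b > 0 such that for every connected graph G = (V,E) on n vertices in which every vertex has degree exactly d and whose Cheeger constant is at least h (i.e., for every X ⊆ V with |X| ≤ n/2, the number of edges with exactly one endpoint in X is at least h·|X|), and for every x ∈ ℝ^n: Σ_{(i,j)∈E} (x_i − x_j)² ≥ b·(h/d)²·d·Σ_{i=1}^n (x_i − x̄)² ≥ b·h²·Δ²/(2d), where x̄ = (1/n)·Σ_i x_i and Δ = max_i x_i − min_i x_i is the diameter of the values x₁,…,x_n. -/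
open scoped BigOperators

lemma chg_edge_sum {n : ℕ} (G : SimpleGraph (Fin n)) [DecidableRel G.Adj] (f : Sym2 (Fin n) → ℝ) :
    ∑ i, ∑ j, (if G.Adj i j then f s(i,j) else 0) = 2 * ∑ e ∈ G.edgeFinset, f e := by
  rw [← Finset.sum_product' (s := Finset.univ) (t := Finset.univ)
    (f := fun i j => if G.Adj i j then f s(i,j) else 0), ← Finset.sum_filter,
    ← Finset.sum_fiberwise_of_maps_to (t := G.edgeFinset) (g := fun p : Fin n × Fin n => s(p.1,p.2)),
    Finset.mul_sum]
  · refine Finset.sum_congr rfl ?_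
    intro e
    induction e using Sym2.ind with
    | _ a b =>
      intro he
      have hab : G.Adj a b := by simpa using he
      have : ((Finset.univ ×ˢ Finset.univ).filter (fun p : Fin n × Fin n => G.Adj p.1 p.2)).filter
          (fun p => s(p.1,p.2) = s(a,b)) = {(a,b),(b,a)} := by
        ext ⟨p, q⟩
        simp only [Finset.mem_filter, Finset.mem_product, Finset.mem_univ, true_and, and_true,
          Finset.mem_insert, Finset.mem_singleton, Prod.mk.injEq, Sym2.eq_iff]
        constructor
        · rintro ⟨_, h⟩
          exact h
        · rintro (⟨rfl, rfl⟩ | ⟨rfl, rfl⟩)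
          · exact ⟨hab, by simp⟩
          · exact ⟨hab.symm, by simp⟩
      rw [this, Finset.sum_pair (by
        intro h
        exact hab.ne (Prod.mk.inj h).1)]
      simp only [Sym2.eq_swap (a := b) (b := a)]
      ring
  · rintro ⟨p, q⟩ h
    simpa using h

lemma chg_coarea {n : ℕ} (G : SimpleGraph (Fin n)) [DecidableRel G.Adj] (h : ℝ)
    (hG : ∀ X : Finset (Fin n), 2 * X.card ≤ n →
            h * X.card ≤ ((X ×ˢ Xᶜ).filter fun e => G.Adj e.1 e.2).card) :
    ∀ (k : ℕ) (w : Fin n → ℝ), (∀ i, 0 ≤ w i) → (Finset.univ.filter fun i => 0 < w i).card = k →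
      2 * k ≤ n → h * ∑ i, w i ≤ ∑ i, ∑ j, (if G.Adj i j then max (w i - w j) 0 else 0) := by
  intro k
  induction k using Nat.strong_induction_on with
  | _ k ih =>
    intro w hw hk hkn
    set X := Finset.univ.filter fun i => 0 < w i with hX
    have hmem : ∀ i, i ∈ X ↔ 0 < w i := by intro i; simp [hX]
    rcases X.eq_empty_or_nonempty with he | hne
    · have h0 : ∀ i, w i = 0 := by
        intro i
        have : ¬ (0 < w i) := by rw [← hmem, he]; simp
        exact le_antisymm (not_lt.mp this) (hw i)
      simp [h0]
    · obtain ⟨a, haX, ha⟩ := Finset.exists_min_image X w hne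
      have hapos : 0 < w a := (hmem a).1 haX
      set m := w a with hm
      let w' : Fin n → ℝ := fun i => if i ∈ X then w i - m else 0
      have hw' : ∀ i, 0 ≤ w' i := by
        intro i
        by_cases hi : i ∈ X
        · simp only [w', hi, if_true]; linarith [ha i hi]
        · simp [w', hi]
      have hlt : (Finset.univ.filter fun i => 0 < w' i).card < k := by
        rw [← hk]
        apply Finset.card_lt_card
        rw [Finset.ssubset_iff_of_subset]
        · exact ⟨a, haX, by simp [w', haX, hm]⟩
        · intro i hi
          by_contra hi'
          simp [w', hi'] at hi
      have key := ih _ hlt w' hw' rfl (by omega)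
      have hc := hG X (by omega)
      have e1 : ∑ i, w i = ∑ i, w' i + m * X.card := by
        have : ∀ i, w i = w' i + (if i ∈ X then m else 0) := by
          intro i
          by_cases hi : i ∈ X
          · simp [w', hi]
          · have : w i = 0 := le_antisymm (not_lt.mp (fun h => hi ((hmem i).2 h))) (hw i)
            simp [w', hi, this]
        rw [Finset.sum_congr rfl (fun i _ => this i), Finset.sum_add_distrib]
        simp [mul_comm]
      have e2 : ∑ i, ∑ j, (if G.Adj i j then max (w i - w j) 0 else 0) =
          ∑ i, ∑ j, (if G.Adj i j then max (w' i - w' j) 0 else 0) +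
          m * ((X ×ˢ Xᶜ).filter fun e => G.Adj e.1 e.2).card := by
        have hcard : m * (((X ×ˢ Xᶜ).filter fun e => G.Adj e.1 e.2).card : ℝ) =
            ∑ i, ∑ j, (if i ∈ X ∧ j ∉ X ∧ G.Adj i j then m else 0) := by
          rw [← Finset.sum_product' (s := Finset.univ) (t := Finset.univ)
            (f := fun i j => if i ∈ X ∧ j ∉ X ∧ G.Adj i j then m else 0), ← Finset.sum_filter,
            Finset.sum_const, nsmul_eq_mul, mul_comm]
          congr 3
          ext ⟨p, q⟩
          simp [and_assoc]
        rw [hcard, ← Finset.sum_add_distrib]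
        refine Finset.sum_congr rfl fun i _ => ?_
        rw [← Finset.sum_add_distrib]
        refine Finset.sum_congr rfl fun j _ => ?_
        have z : ∀ i, i ∉ X → w i = 0 := fun i hi =>
          le_antisymm (not_lt.mp (fun h => hi ((hmem i).2 h))) (hw i)
        by_cases hA : G.Adj i j
        · by_cases hi : i ∈ X <;> by_cases hj : j ∈ X
          · simp [w', hA, hi, hj]
          · have := ha i hi
            simp only [w', hA, hi, hj, z j hj, if_true, if_false, not_false_eq_true, and_self]
            rw [max_eq_left (by linarith), max_eq_left (by linarith)]; ring
          · have := ha j hj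
            simp only [w', hA, hi, hj, z i hi, if_true, if_false, false_and]
            rw [max_eq_right (by linarith), max_eq_right (by linarith)]; ring
          · simp [w', hA, hi, hj, z i hi, z j hj]
        · simp [hA]
      rw [e1, e2]
      nlinarith [mul_le_mul_of_nonneg_left hc hapos.le]

lemma chg_half {n d : ℕ} (G : SimpleGraph (Fin n)) [DecidableRel G.Adj] (h : ℝ) (hd : 1 ≤ d)
    (hh : 0 < h) (hdeg : ∀ i, G.degree i = d)
    (hG : ∀ X : Finset (Fin n), 2 * X.card ≤ n →
            h * X.card ≤ ((X ×ˢ Xᶜ).filter fun e => G.Adj e.1 e.2).card)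
    (z : Fin n → ℝ) (hz : ∀ i, 0 ≤ z i) (hs : 2 * (Finset.univ.filter fun i => 0 < z i).card ≤ n) :
    h ^ 2 / d * ∑ i, z i ^ 2 ≤ ∑ i, ∑ j, (if G.Adj i j then (z i - z j) ^ 2 else 0) := by
  have hd' : (0:ℝ) < d := by exact_mod_cast hd
  have hf : (Finset.univ.filter fun i => 0 < z i ^ 2) = (Finset.univ.filter fun i => 0 < z i) := by
    ext i
    simp only [Finset.mem_filter, Finset.mem_univ, true_and]
    exact ⟨fun h => lt_of_le_of_ne (hz i) (fun h0 => by simp [← h0] at h), fun h => by positivity⟩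
  have h1 := chg_coarea G h hG _ (fun i => z i ^ 2) (fun i => sq_nonneg _) rfl (by rw [hf]; exact hs)
  have r1 : ∑ i, ∑ j, (if G.Adj i j then z i ^ 2 else 0) = d * ∑ i, z i ^ 2 := by
    rw [Finset.mul_sum]
    refine Finset.sum_congr rfl fun i _ => ?_
    rw [← Finset.sum_filter, Finset.sum_const, nsmul_eq_mul, ← hdeg i,
      ← SimpleGraph.card_neighborFinset_eq_degree, SimpleGraph.neighborFinset_eq_filter]
  have r2 : ∑ i, ∑ j, (if G.Adj i j then z j ^ 2 else 0) = d * ∑ i, z i ^ 2 := by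
    rw [Finset.sum_comm, ← r1]
    simp only [G.adj_comm]
  have h2 : ∑ i, ∑ j, (if G.Adj i j then max (z j ^ 2 - z i ^ 2) 0 else 0) =
      ∑ i, ∑ j, (if G.Adj i j then max (z i ^ 2 - z j ^ 2) 0 else 0) := by
    rw [Finset.sum_comm]
    simp only [G.adj_comm]
  have h3 : ∑ i, ∑ j, (if G.Adj i j then max (z i ^ 2 - z j ^ 2) 0 else 0) +
      ∑ i, ∑ j, (if G.Adj i j then max (z j ^ 2 - z i ^ 2) 0 else 0) ≤
      (d / h) * ∑ i, ∑ j, (if G.Adj i j then (z i - z j) ^ 2 else 0) +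
      (h / (2 * d)) * (∑ i, ∑ j, (if G.Adj i j then z i ^ 2 else 0) +
        ∑ i, ∑ j, (if G.Adj i j then z j ^ 2 else 0)) := by
    simp only [Finset.mul_sum, ← Finset.sum_add_distrib]
    refine Finset.sum_le_sum fun i _ => Finset.sum_le_sum fun j _ => ?_
    by_cases hA : G.Adj i j
    · simp only [hA, if_true]
      have e : max (z i ^ 2 - z j ^ 2) 0 + max (z j ^ 2 - z i ^ 2) 0
          = |z i - z j| * (z i + z j) := by
        rw [← abs_of_nonneg (add_nonneg (hz i) (hz j)), ← abs_mul,
          show (z i - z j) * (z i + z j) = z i ^ 2 - z j ^ 2 by ring]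
        rcases le_total (z i ^ 2) (z j ^ 2) with hl | hl
        · rw [max_eq_right (by linarith), max_eq_left (by linarith), abs_of_nonpos (by linarith)]
          ring
        · rw [max_eq_left (by linarith), max_eq_right (by linarith), abs_of_nonneg (by linarith)]
          ring
      rw [e, ← sq_abs (z i - z j)]
      set u := |z i - z j|
      have e3 : (d / h) * u ^ 2 + (h / (2 * d)) * (z i ^ 2 + z j ^ 2) - u * (z i + z j)
         = (d / h) * (u - h / (2 * d) * (z i + z j)) ^ 2 + h / (4 * d) * (z i - z j) ^ 2 := by
        field_simp
        ring
      have : 0 ≤ (d / h) * (u - h / (2 * d) * (z i + z j)) ^ 2 + h / (4 * d) * (z i - z j) ^ 2 := by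
        positivity
      linarith
    · simp [hA]
  rw [h2, r1, r2] at h3
  set D := ∑ i, ∑ j, (if G.Adj i j then (z i - z j) ^ 2 else 0)
  set Z := ∑ i, z i ^ 2
  have h4 : h * Z ≤ d / h * D := by
    have : h / (2 * d) * (d * Z + d * Z) = h * Z := by field_simp; ring
    linarith
  have h5 := mul_le_mul_of_nonneg_left h4 (show 0 ≤ h / d by positivity)
  have e5 : h / d * (d / h * D) = D := by field_simp
  have e6 : h / d * (h * Z) = h ^ 2 / d * Z := by ring
  linarith

lemma chg_median {n : ℕ} (hn : 0 < n) (x : Fin n → ℝ) : ∃ m : ℝ,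
    2 * (Finset.univ.filter fun i => m < x i).card ≤ n ∧
    2 * (Finset.univ.filter fun i => x i < m).card ≤ n := by
  haveI : NeZero n := ⟨hn.ne'⟩
  let K := Finset.univ.filter fun k => 2 * (Finset.univ.filter fun i => x k < x i).card ≤ n
  have hK : K.Nonempty := by
    obtain ⟨k, _, hk⟩ := Finset.exists_max_image Finset.univ x ⟨(0 : Fin n), Finset.mem_univ _⟩
    refine ⟨k, ?_⟩
    have : (Finset.univ.filter fun i => x k < x i) = ∅ := by
      ext i; simpa using hk i (Finset.mem_univ _)
    simp [K, this]
  obtain ⟨k, hkK, hk⟩ := Finset.exists_min_image K x hK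
  refine ⟨x k, by simpa [K] using hkK, ?_⟩
  by_contra hcon
  push Not at hcon
  have hne : (Finset.univ.filter fun i => x i < x k).Nonempty := by
    rw [← Finset.card_pos]; omega
  obtain ⟨v, hv, hvm⟩ := Finset.exists_max_image _ x hne
  have hvk : x v < x k := by simpa using hv
  have hvK : v ∈ K := by
    have hsub : (Finset.univ.filter fun i => x v < x i) ⊆
        (Finset.univ.filter fun i => x i < x k)ᶜ := by
      intro i hi
      simp only [Finset.mem_compl]
      intro hi'
      have := hvm i hi'
      simp at hi
      linarith
    have := Finset.card_le_card hsub
    rw [Finset.card_compl, Fintype.card_fin] at this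
    simp only [K, Finset.mem_filter, Finset.mem_univ, true_and]
    omega
  linarith [hk v hvK]

/-- Cheeger's inequality. There is an absolute constant `b > 0` such
that for every connected `d`-regular graph `G` on `n ≥ 2` vertices whose Cheeger
constant is at least `h` (for every `X ⊆ V` with `|X| ≤ n/2`, the number of edges with
exactly one endpoint in `X` is at least `h·|X|`), and for every `x ∈ ℝⁿ`:
`∑_{(i,j)∈E} (x_i − x_j)² ≥ b·(h/d)²·d·∑ i (x_i − x̄)² ≥ b·h²·Δ²/(2d)`, where
`x̄ = (1/n)∑ i x_i` and `Δ = max x − min x`. -/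
theorem cheeger_inequality :
    ∃ b : ℝ, 0 < b ∧
      ∀ (n d : ℕ) (h : ℝ), 2 ≤ n → 1 ≤ d → 0 < h →
        ∀ (G : SimpleGraph (Fin n)) (_ : DecidableRel G.Adj),
          G.Connected →
          (∀ i, G.degree i = d) →
          (∀ X : Finset (Fin n), 2 * X.card ≤ n →
            h * X.card ≤ ((X ×ˢ Xᶜ).filter fun e => G.Adj e.1 e.2).card) →
          ∀ x : Fin n → ℝ,
            (b * (h / d) ^ 2 * ((d : ℝ) * ∑ i, (x i - (∑ j, x j) / n) ^ 2) ≤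
              ∑ e ∈ G.edgeFinset,
                Sym2.lift ⟨fun i j => (x i - x j) ^ 2, fun i j => by ring⟩ e) ∧
            b * h ^ 2 * ((⨆ i, x i) - (⨅ i, x i)) ^ 2 / (2 * d) ≤
              b * (h / d) ^ 2 * ((d : ℝ) * ∑ i, (x i - (∑ j, x j) / n) ^ 2) := by
  refine ⟨1 / 2, by norm_num, ?_⟩
  intro n d h hn hd hh G _ hconn hdeg hG x
  have hd' : (0:ℝ) < d := by exact_mod_cast hd
  have hn' : (0:ℝ) < n := by exact_mod_cast (by omega : 0 < n)
  haveI : NeZero n := ⟨by omega⟩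
  set μ := (∑ j, x j) / n with hμ
  have hre : ∀ S : ℝ, 1 / 2 * (h / d) ^ 2 * ((d : ℝ) * S) = 1 / 2 * (h ^ 2 / d * S) := by
    intro S; field_simp
  rw [hre]
  constructor
  · obtain ⟨m, hm1, hm2⟩ := chg_median (by omega) x
    have p1 := chg_half G h hd hh hdeg hG (fun i => max (x i - m) 0) (fun i => le_max_right _ _)
      (by simpa using hm1)
    have p2 := chg_half G h hd hh hdeg hG (fun i => max (m - x i) 0) (fun i => le_max_right _ _)
      (by simpa using hm2)
    have hE := chg_edge_sum G (Sym2.lift ⟨fun i j => (x i - x j) ^ 2, fun i j => by ring⟩)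
    simp only [Sym2.lift_mk] at hE
    have hsum : ∑ i, ∑ j, (if G.Adj i j then (max (x i - m) 0 - max (x j - m) 0) ^ 2 else 0) +
        ∑ i, ∑ j, (if G.Adj i j then (max (m - x i) 0 - max (m - x j) 0) ^ 2 else 0) ≤
        ∑ i, ∑ j, (if G.Adj i j then (x i - x j) ^ 2 else 0) := by
      simp only [← Finset.sum_add_distrib]
      refine Finset.sum_le_sum fun i _ => Finset.sum_le_sum fun j _ => ?_
      split_ifs
      · rcases le_total (x i) m with hi | hi <;> rcases le_total (x j) m with hj | hj <;>
        simp only [max_eq_left (sub_nonneg.2 hi), max_eq_right (sub_nonpos.2 hi),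
          max_eq_left (sub_nonneg.2 hj), max_eq_right (sub_nonpos.2 hj)] <;>
        nlinarith [mul_nonneg (sub_nonneg.2 hi) (sub_nonneg.2 hj)]
      · simp
    have hZ : ∑ i, (x i - μ) ^ 2 ≤ ∑ i, (max (x i - m) 0) ^ 2 + ∑ i, (max (m - x i) 0) ^ 2 := by
      have a1 : ∑ i, (max (x i - m) 0) ^ 2 + ∑ i, (max (m - x i) 0) ^ 2 = ∑ i, (x i - m) ^ 2 := by
        rw [← Finset.sum_add_distrib]
        refine Finset.sum_congr rfl fun i _ => ?_
        rcases le_total (x i) m with hi | hi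
        · rw [max_eq_left (sub_nonneg.2 hi), max_eq_right (sub_nonpos.2 hi)]; ring
        · rw [max_eq_left (sub_nonneg.2 hi), max_eq_right (sub_nonpos.2 hi)]; ring
      have a2 : ∑ i, (x i - m) ^ 2 = ∑ i, (x i - μ) ^ 2 + n * (μ - m) ^ 2 := by
        have : ∀ i, (x i - m) ^ 2 = (x i - μ) ^ 2 + (2 * (μ - m) * x i - 2 * (μ - m) * μ +
            (μ - m) ^ 2) := by intro i; ring
        rw [Finset.sum_congr rfl (fun i _ => this i), Finset.sum_add_distrib,
          Finset.sum_add_distrib, Finset.sum_sub_distrib, ← Finset.mul_sum]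
        have : ∑ j, x j = n * μ := by rw [hμ]; field_simp
        rw [this]
        simp
        ring
      rw [a1, a2]
      have : 0 ≤ n * (μ - m) ^ 2 := by positivity
      linarith
    have hZ' := mul_le_mul_of_nonneg_left hZ (show 0 ≤ h ^ 2 / d by positivity)
    rw [mul_add] at hZ'
    linarith
  · obtain ⟨a, ha⟩ := exists_eq_ciSup_of_finite (f := x)
    obtain ⟨b, hb⟩ := exists_eq_ciInf_of_finite (f := x)
    rw [← ha, ← hb]
    have hS : (x a - x b) ^ 2 / 2 ≤ ∑ i, (x i - μ) ^ 2 := by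
      by_cases hab : a = b
      · subst hab
        simp only [sub_self]
        have : 0 ≤ ∑ i, (x i - μ) ^ 2 := Finset.sum_nonneg fun i _ => sq_nonneg _
        simpa using this
      · have := Finset.sum_le_sum_of_subset_of_nonneg (Finset.subset_univ ({a, b} : Finset (Fin n)))
          (f := fun i => (x i - μ) ^ 2) (fun i _ _ => sq_nonneg _)
        rw [Finset.sum_pair hab] at this
        nlinarith [sq_nonneg (x a - μ + (x b - μ))]
    have := mul_le_mul_of_nonneg_left hS (show 0 ≤ 1 / 2 * (h ^ 2 / d) by positivity)
    have e : 1 / 2 * h ^ 2 * (x a - x b) ^ 2 / (2 * d) =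
      1 / 2 * (h ^ 2 / d) * ((x a - x b) ^ 2 / 2) := by field_simp
    rw [e]
    linarith
end
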